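/- arXiv:alg-geom/9312004 — 3 statements merged into one kernel-verified Lean document; each statement's English description precedes it below -/
import Mathlib

section
/- Let k be a field, R a graded k-algebra with R_0 = k, and A a graded factor algebra of R which is Koszul. Suppose there exists a complex K^· of free right R-modules of the form ... → V_2 ⊗ R(-2) → V_1 ⊗ R(-1) → R (so K^i = V_i ⊗ R(-i) with V_i finite-dimensional k-vector spaces and V_0 = k) such that H_0(K^·) = A and H_p(K^·)_j = 0 for all p ≥ 1 and all j > p+1. Then R is Koszul and A admits a linear free resolution as an R-module, i.e. a resolution of the form ... → U_2 ⊗ R(-2) → U_1 ⊗ R(-1) → R → A → 0 with U_i finite-dimensional k-vector spaces. -/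
open TensorProduct Function

noncomputable section


/-!  ### Graded algebras presented by their components

An ℕ-graded algebra `R = ⊕ₙ Rₙ` over a field `k` (with `R₀ = k`) is presented here through
its graded components, realized as `k`-subspaces `piece n` of an ambient `k`-algebra `A`,
with `1 ∈ piece 0` and `piece m * piece n ⊆ piece (m + n)`.  All notions below (Koszulness,
quadraticity) depend only on the components and the componentwise multiplication maps. -/
structure GradedSystem (k A : Type) [Field k] [Ring A] [Algebra k A] where
  piece : ℕ → Submodule k A
  one_mem : (1 : A) ∈ piece 0
  mul_mem : ∀ {m n : ℕ} {x y : A}, x ∈ piece m → y ∈ piece n → x * y ∈ piece (m + n)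

namespace GradedSystem

variable {k A : Type} [Field k] [Ring A] [Algebra k A] (S : GradedSystem k A)

/-- The componentwise multiplication map `Rₘ ⊗ Rₙ → R_{m+n}`. -/
def mulMap (m n : ℕ) : S.piece m →ₗ[k] S.piece n →ₗ[k] S.piece (m + n) :=
  LinearMap.mk₂ k (fun x y => ⟨(x : A) * (y : A), S.mul_mem x.2 y.2⟩)
    (fun x x' y => Subtype.ext (by simp [add_mul]))
    (fun c x y => Subtype.ext (by simp [smul_mul_assoc]))
    (fun x y y' => Subtype.ext (by simp [mul_add]))
    (fun c x y => Subtype.ext (by simp [mul_smul_comm]))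

/-- Transport of a graded component along an equality of degrees. -/
def cast {m n : ℕ} (h : m = n) : (S.piece m : Type) ≃ₗ[k] S.piece n :=
  LinearEquiv.ofEq _ _ (by rw [h])

/-- The degree-`d` component of the differential
`V_{i+1} ⊗ R(-(i+1)) → V_i ⊗ R(-i)` of a complex of free graded (right) `R`-modules with
`V_i = k^{n i}` generated in degree `i`; the differential is encoded by its
restriction `φ i : V_{i+1} → V_i ⊗ R₁` to the generators (a "matrix of linear forms").
The degree-`(i+1+d)` component of the map is `V_{i+1} ⊗ R_d → V_i ⊗ R_{d+1}`. -/
def Dmap (n : ℕ → ℕ)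
    (φ : ∀ i : ℕ, (Fin (n (i + 1)) → k) →ₗ[k] ((Fin (n i) → k) ⊗[k] S.piece 1))
    (i d : ℕ) :
    ((Fin (n (i + 1)) → k) ⊗[k] S.piece d) →ₗ[k] ((Fin (n i) → k) ⊗[k] S.piece (d + 1)) :=
  (LinearMap.lTensor (Fin (n i) → k)
      ((S.cast (add_comm 1 d)).toLinearMap ∘ₗ TensorProduct.lift (S.mulMap 1 d))) ∘ₗ
    (TensorProduct.assoc k (Fin (n i) → k) (S.piece 1) (S.piece d)).toLinearMap ∘ₗ
    (LinearMap.rTensor (S.piece d) (φ i))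

/-- `S` is connected: the degree-zero component is spanned by the unit, i.e. `R₀ = k`. -/
def ConnectedOne : Prop := S.piece 0 = Submodule.span k {(1 : A)}

/-- `S` is a *Koszul algebra*: `R₀ = k` and the trivial module `k` admits a linear free
resolution `⋯ → V₂ ⊗ R(-2) → V₁ ⊗ R(-1) → R → k → 0` (this is one of the standard
equivalent definitions of Koszulness: `Extⁿ(k, k(-m)) = 0` for `n ≠ m`).
Exactness is expressed by its graded components: surjectivity of `V₁ ⊗ R_d → R_{d+1}`
(exactness at `R` in positive degrees), injectivity of `V_{i+1} ⊗ R₀ → V_i ⊗ R₁`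
(exactness in the lowest degree at each spot), and `range = ker` elsewhere. -/
def IsKoszul : Prop :=
  S.ConnectedOne ∧
  ∃ (n : ℕ → ℕ)
    (φ : ∀ i : ℕ, (Fin (n (i + 1)) → k) →ₗ[k] ((Fin (n i) → k) ⊗[k] S.piece 1)),
    n 0 = 1 ∧
    (∀ d : ℕ, Surjective (S.Dmap n φ 0 d)) ∧
    (∀ i : ℕ, Injective (S.Dmap n φ i 0)) ∧
    (∀ i d : ℕ, LinearMap.range (S.Dmap n φ (i + 1) d) = LinearMap.ker (S.Dmap n φ i (d + 1)))

/-- `S` is a *quadratic algebra*: `R₀ = k`, `R` is generated by `R₁` and its relations are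
generated in degree `2`; equivalently there is an exact sequence
`V₂ ⊗ R(-2) → V₁ ⊗ R(-1) → R → k → 0` (exact at `V₁ ⊗ R(-1)` and at `R`). -/
def IsQuadratic : Prop :=
  S.ConnectedOne ∧
  ∃ (n : ℕ → ℕ)
    (φ : ∀ i : ℕ, (Fin (n (i + 1)) → k) →ₗ[k] ((Fin (n i) → k) ⊗[k] S.piece 1)),
    n 0 = 1 ∧
    (∀ d : ℕ, Surjective (S.Dmap n φ 0 d)) ∧
    Injective (S.Dmap n φ 0 0) ∧
    (∀ d : ℕ, LinearMap.range (S.Dmap n φ 1 d) = LinearMap.ker (S.Dmap n φ 0 (d + 1)))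

end GradedSystem

/-- For `m = 1`, the canonical identification `(k^m) ⊗ M ≃ M`. -/
def oneTensorEquiv {k : Type} [Field k] {m : ℕ} (h : m = 1) (M : Type)
    [AddCommGroup M] [Module k M] : ((Fin m → k) ⊗[k] M) ≃ₗ[k] M :=
  (TensorProduct.congr
      ((LinearEquiv.funCongrLeft k k (finCongr h.symm)).trans
        (LinearEquiv.funUnique (Fin 1) k k))
      (LinearEquiv.refl k M)).trans (TensorProduct.lid k M)


namespace GradedSystem

section Modules

variable {k A : Type} [Field k] [Ring A] [Algebra k A]

/-- The graded components of `S`, extended by zero to negative degrees. -/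
def pz (S : GradedSystem k A) (j : ℤ) : Submodule k A :=
  if 0 ≤ j then S.piece j.toNat else ⊥

lemma pz_natCast (S : GradedSystem k A) (n : ℕ) : S.pz n = S.piece n := by simp [pz]

lemma pz_of_neg (S : GradedSystem k A) {j : ℤ} (h : j < 0) : S.pz j = ⊥ := by
  simp [pz, h]

lemma one_mem_pz (S : GradedSystem k A) : (1 : A) ∈ S.pz 0 := by
  simpa [pz] using S.one_mem

lemma mul_mem_pz (S : GradedSystem k A) {i j l : ℤ} (h : i + j = l) {x y : A}
    (hx : x ∈ S.pz i) (hy : y ∈ S.pz j) : x * y ∈ S.pz l := by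
  by_cases hi : i < 0
  · rw [S.pz_of_neg hi, Submodule.mem_bot] at hx
    simp [hx]
  by_cases hj : j < 0
  · rw [S.pz_of_neg hj, Submodule.mem_bot] at hy
    simp [hy]
  obtain ⟨a, rfl⟩ := Int.eq_ofNat_of_zero_le (not_lt.1 hi)
  obtain ⟨b, rfl⟩ := Int.eq_ofNat_of_zero_le (not_lt.1 hj)
  obtain rfl : ((a + b : ℕ) : ℤ) = l := by rw [← h]; push_cast; rfl
  rw [pz_natCast] at hx hy ⊢
  exact S.mul_mem hx hy

/-- A `ℤ`-graded right module over the graded algebra `S`, given by its components. -/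
structure RMod (S : GradedSystem k A) where
  X : ℤ → Type
  [acg : ∀ l, AddCommGroup (X l)]
  [mod : ∀ l, Module k (X l)]
  act : ∀ {i j l : ℤ}, i + j = l → X i →ₗ[k] S.pz j →ₗ[k] X l
  act_one : ∀ {i : ℤ} (h : i + 0 = i) (x : X i), act h x ⟨1, S.one_mem_pz⟩ = x
  act_act : ∀ {i j p j' l q : ℤ} (h : i + j = p) (h' : p + j' = l) (hq : j + j' = q)
    (h'' : i + q = l) (x : X i) (r : S.pz j) (r' : S.pz j'),
    act h' (act h x r) r' = act h'' x ⟨r * r', S.mul_mem_pz hq r.2 r'.2⟩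

attribute [instance] RMod.acg RMod.mod

namespace RMod

variable {S : GradedSystem k A}

lemma act_of_neg (M : S.RMod) {i j l : ℤ} (h : i + j = l) (hj : j < 0) (x : M.X i) (r : S.pz j) :
    M.act h x r = 0 := by
  have : r = 0 := Subtype.ext ((Submodule.mem_bot k).1 (S.pz_of_neg hj ▸ r.2))
  simp [this]

/-- Degree-preserving homomorphisms of graded right modules. -/
structure Hom (M N : S.RMod) where
  f : ∀ l, M.X l →ₗ[k] N.X l
  map_act : ∀ {i j l : ℤ} (h : i + j = l) (x : M.X i) (r : S.pz j),
    f l (M.act h x r) = N.act h (f i x) r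

/-- Componentwise surjectivity. -/
def Hom.Surj {M N : S.RMod} (f : Hom M N) : Prop := ∀ l, Surjective (f.f l)

/-- Componentwise injectivity. -/
def Hom.Inj {M N : S.RMod} (f : Hom M N) : Prop := ∀ l, Injective (f.f l)

/-- Composition of homomorphisms. -/
def Hom.comp {M N P : S.RMod} (g : Hom N P) (f : Hom M N) : Hom M P where
  f l := g.f l ∘ₗ f.f l
  map_act h x r := by simp [f.map_act, g.map_act]

/-- The identity homomorphism. -/
def Hom.id (M : S.RMod) : Hom M M where
  f _ := LinearMap.id
  map_act _ _ _ := rfl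

/-- Graded submodules. -/
@[ext]
structure Sub (M : S.RMod) where
  carrier : ∀ l, Submodule k (M.X l)
  act_mem : ∀ {i j l : ℤ} (h : i + j = l) {x : M.X i} (_ : x ∈ carrier i) (r : S.pz j),
    M.act h x r ∈ carrier l

/-- A graded submodule as a graded module. -/
abbrev Sub.toRMod {M : S.RMod} (N : Sub M) : S.RMod where
  X l := N.carrier l
  act {i j l} h := LinearMap.mk₂ k (fun x r => ⟨M.act h x.1 r, N.act_mem h x.2 r⟩)
    (fun x x' y => Subtype.ext (by simp)) (fun c x y => Subtype.ext (by simp))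
    (fun x y y' => Subtype.ext (by simp)) (fun c x y => Subtype.ext (by simp))
  act_one h x := Subtype.ext (M.act_one h x.1)
  act_act h h' hq h'' x r r' := Subtype.ext (M.act_act h h' hq h'' x.1 r r')

/-- The inclusion of a graded submodule. -/
def Sub.incl {M : S.RMod} (N : Sub M) : Hom N.toRMod M where
  f l := (N.carrier l).subtype
  map_act _ _ _ := rfl

/-- Restriction of the codomain to a graded submodule. -/
def Sub.codRestrict {M P : S.RMod} (N : Sub M) (f : Hom P M) (h : ∀ l x, f.f l x ∈ N.carrier l) :
    Hom P N.toRMod where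
  f l := (f.f l).codRestrict _ (h l)
  map_act h x r := Subtype.ext (f.map_act h x r)

/-- The preimage of a graded submodule. -/
def Sub.comap {M P : S.RMod} (N : Sub M) (f : Hom P M) : Sub P where
  carrier l := (N.carrier l).comap (f.f l)
  act_mem h x hx r := by
    rw [Submodule.mem_comap, f.map_act]
    exact N.act_mem h hx r

/-- The kernel of a homomorphism. -/
def Hom.ker {M N : S.RMod} (f : Hom M N) : Sub M where
  carrier l := LinearMap.ker (f.f l)
  act_mem h x hx r := by
    rw [LinearMap.mem_ker] at hx ⊢
    rw [f.map_act, hx]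
    simp

/-- The range of a homomorphism. -/
def Hom.range {M N : S.RMod} (f : Hom M N) : Sub N where
  carrier l := LinearMap.range (f.f l)
  act_mem h x hx r := by
    obtain ⟨y, rfl⟩ := hx
    exact ⟨M.act h y r, f.map_act h y r⟩

/-- The corestriction of a homomorphism to its range. -/
def Hom.toRange {M N : S.RMod} (f : Hom M N) : Hom M f.range.toRMod :=
  f.range.codRestrict f (fun _ x => ⟨x, rfl⟩)

lemma Hom.toRange_surj {M N : S.RMod} (f : Hom M N) : f.toRange.Surj := by
  rintro l ⟨_, y, rfl⟩
  exact ⟨y, rfl⟩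

lemma Sub.ker_codRestrict {M P : S.RMod} (N : Sub M) (f : Hom P M)
    (h : ∀ l x, f.f l x ∈ N.carrier l) : (N.codRestrict f h).ker = f.ker := by
  ext l x
  exact Subtype.ext_iff

lemma Hom.ker_toRange {M N : S.RMod} (f : Hom M N) : f.toRange.ker = f.ker :=
  f.range.ker_codRestrict f _

/-- The quotient by a graded submodule. -/
abbrev Sub.quot {M : S.RMod} (N : Sub M) : S.RMod where
  X l := M.X l ⧸ N.carrier l
  act {i j l} h := (N.carrier i).liftQ ((M.act h).compr₂ (N.carrier l).mkQ) (by
    intro x hx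
    rw [LinearMap.mem_ker]
    ext r
    exact (Submodule.Quotient.mk_eq_zero _).2 (N.act_mem h hx r))
  act_one {i} h x := by
    obtain ⟨y, rfl⟩ := Submodule.mkQ_surjective _ x
    exact congrArg (N.carrier i).mkQ (M.act_one h y)
  act_act {i j p j' l q} h h' hq h'' x r r' := by
    obtain ⟨y, rfl⟩ := Submodule.mkQ_surjective _ x
    exact congrArg (N.carrier l).mkQ (M.act_act h h' hq h'' y r r')

/-- The quotient homomorphism. -/
def Sub.mkQ {M : S.RMod} (N : Sub M) : Hom M N.quot where
  f l := (N.carrier l).mkQ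
  map_act _ _ _ := rfl

lemma Sub.mkQ_surj {M : S.RMod} (N : Sub M) : N.mkQ.Surj :=
  fun l => Submodule.mkQ_surjective (N.carrier l)

lemma Sub.ker_mkQ {M : S.RMod} (N : Sub M) : N.mkQ.ker = N := by
  ext l x
  exact Submodule.Quotient.mk_eq_zero _

/-- The product of two graded modules. -/
abbrev prod (M N : S.RMod) : S.RMod where
  X l := M.X l × N.X l
  act h := LinearMap.mk₂ k (fun x r => (M.act h x.1 r, N.act h x.2 r))
    (by intros; simp) (by intros; simp) (by intros; simp) (by intros; simp)
  act_one h x := Prod.ext (M.act_one h x.1) (N.act_one h x.2)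
  act_act h h' hq h'' x r r' :=
    Prod.ext (M.act_act h h' hq h'' x.1 r r') (N.act_act h h' hq h'' x.2 r r')

/-- The homomorphism out of a product given by a pair of homomorphisms. -/
abbrev Hom.coprod {M N P : S.RMod} (f : Hom M P) (g : Hom N P) : Hom (M.prod N) P where
  f l := LinearMap.coprod (f.f l) (g.f l)
  map_act {i j l} h x r := by
    change f.f l (M.act h x.1 r) + g.f l (N.act h x.2 r) = P.act h (f.f i x.1 + g.f i x.2) r
    rw [f.map_act, g.map_act, map_add, LinearMap.add_apply]

/-- The tensor product of a vector space with a graded module. -/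
abbrev tensor (V : Type) [AddCommGroup V] [Module k V] (M : S.RMod) : S.RMod where
  X l := V ⊗[k] M.X l
  act h := ((LinearMap.lTensorHom V).comp (M.act h).flip).flip
  act_one {i} h x := by
    change V ⊗[k] _ at x
    induction x with
    | zero => simp
    | tmul v y => exact congrArg (v ⊗ₜ[k] ·) (M.act_one h y)
    | add a b ha hb => rw [map_add, LinearMap.add_apply, ha, hb]
  act_act {i j p j' l q} h h' hq h'' x r r' := by
    change V ⊗[k] _ at x
    induction x with
    | zero => simp
    | tmul v y => exact congrArg (v ⊗ₜ[k] ·) (M.act_act h h' hq h'' y r r')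
    | add a b ha hb => simp only [map_add, LinearMap.add_apply, ha, hb]

/-- The tensor product of a vector space with a homomorphism. -/
def Hom.tensor (V : Type) [AddCommGroup V] [Module k V] {M N : S.RMod} (f : Hom M N) :
    Hom (M.tensor V) (N.tensor V) where
  f l := (f.f l).lTensor V
  map_act {i j l} h x r := by
    change V ⊗[k] _ at x
    induction x with
    | zero => simp
    | tmul v y => exact congrArg (v ⊗ₜ[k] ·) (f.map_act h y r)
    | add a b ha hb => simp only [map_add, LinearMap.add_apply, ha, hb]

/-- The graded module of linear maps from a vector space. -/
abbrev homMod (V : Type) [AddCommGroup V] [Module k V] (M : S.RMod) : S.RMod where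
  X l := V →ₗ[k] M.X l
  act h := LinearMap.mk₂ k (fun f r => ((M.act h).flip r).comp f)
    (by intros; ext; simp) (by intros; ext; simp) (by intros; ext; simp) (by intros; ext; simp)
  act_one h f := LinearMap.ext fun v => M.act_one h (f v)
  act_act h h' hq h'' f r r' := LinearMap.ext fun v => M.act_act h h' hq h'' (f v) r r'

/-- The shift `M(-s)`. -/
abbrev shift (s : ℤ) (M : S.RMod) : S.RMod where
  X l := M.X (l - s)
  act {i j l} h := M.act (show i - s + j = l - s by omega)
  act_one h x := M.act_one _ x
  act_act h h' hq h'' x r r' := M.act_act _ _ hq _ x r r'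

/-- The shift of a homomorphism. -/
def Hom.shift (s : ℤ) {M N : S.RMod} (f : Hom M N) : Hom (M.shift s) (N.shift s) where
  f l := f.f (l - s)
  map_act _ x r := f.map_act _ x r

/-- Transport along an equality of degrees. -/
def tr (M : S.RMod) {i l : ℤ} (h : i = l) : M.X i ≃ₗ[k] M.X l :=
  h ▸ LinearEquiv.refl k (M.X i)

lemma tr_rfl (M : S.RMod) {i : ℤ} (x : M.X i) : M.tr rfl x = x := rfl

lemma tr_tr (M : S.RMod) {i l p : ℤ} (h : i = l) (h' : l = p) (x : M.X i) :
    M.tr h' (M.tr h x) = M.tr (h.trans h') x := by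
  subst h h'; rfl

lemma tr_act (M : S.RMod) {i j l i' l' : ℤ} (hi : i = i') (hl : l = l') (h : i + j = l)
    (h' : i' + j = l') (x : M.X i) (r : S.pz j) :
    M.tr hl (M.act h x r) = M.act h' (M.tr hi x) r := by
  subst hi hl; rfl

lemma Hom.map_tr {M N : S.RMod} (f : Hom M N) {i l : ℤ} (h : i = l) (x : M.X i) :
    f.f l (M.tr h x) = N.tr h (f.f i x) := by
  subst h; rfl

/-- The regular right module. -/
abbrev regular (S : GradedSystem k A) : S.RMod where
  X l := S.pz l
  act h := LinearMap.mk₂ k (fun x r => ⟨x.1 * r.1, S.mul_mem_pz h x.2 r.2⟩)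
    (fun x x' y => Subtype.ext (by simp [add_mul]))
    (fun c x y => Subtype.ext (by simp))
    (fun x y y' => Subtype.ext (by simp [mul_add]))
    (fun c x y => Subtype.ext (by simp))
  act_one h x := Subtype.ext (mul_one x.1)
  act_act h h' hq h'' x r r' := Subtype.ext (mul_assoc x.1 r.1 r'.1)

/-- The free module `V ⊗ S(-s)`. -/
abbrev free (S : GradedSystem k A) (V : Type) [AddCommGroup V] [Module k V] (s : ℤ) : S.RMod :=
  ((regular S).shift s).tensor V

/-- Homomorphisms out of a free module. -/
def freeLift {V : Type} [AddCommGroup V] [Module k V] {s : ℤ} {M : S.RMod} (φ : V →ₗ[k] M.X s) :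
    Hom (free S V s) M where
  f l := TensorProduct.lift (M.act (show s + (l - s) = l by omega) ∘ₗ φ)
  map_act {i j l} h x r := by
    change V ⊗[k] _ at x
    induction x with
    | zero => simp
    | tmul v y => exact (M.act_act _ h (by omega) _ (φ v) y r).symm
    | add a b ha hb => simp only [map_add, LinearMap.add_apply, ha, hb]

/-! ### Projectivity and generation in bounded degrees -/

/-- The lifting property against surjections. -/
def Proj (F : S.RMod) : Prop :=
  ∀ (M N : S.RMod) (p : Hom M N) (f : Hom F N), p.Surj →
    ∃ g : Hom F M, ∀ l x, p.f l (g.f l x) = f.f l x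

/-- Generation in degrees `≤ g`. -/
def Gen (g : ℤ) (F : S.RMod) : Prop :=
  ∀ N : Sub F, (∀ l ≤ g, N.carrier l = ⊤) → ∀ l, N.carrier l = ⊤

lemma Gen.mono {g g' : ℤ} {F : S.RMod} (h : Gen g F) (hg : g ≤ g') : Gen g' F :=
  fun N hN => h N fun l hl => hN l (hl.trans hg)

lemma proj_regular (S : GradedSystem k A) : Proj (regular S) := by
  intro M N p f hp
  obtain ⟨m, hm⟩ := hp 0 (f.f 0 (⟨1, S.one_mem_pz⟩ : S.pz 0))
  refine ⟨⟨fun l => M.act (zero_add l) m, fun h x r => (M.act_act _ h h _ m x r).symm⟩, ?_⟩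
  intro l x
  refine (p.map_act (zero_add l) m x).trans ?_
  rw [hm]
  refine (f.map_act (zero_add l) _ x).symm.trans (congrArg (f.f l) ?_)
  exact Subtype.ext (one_mul _)

lemma gen_regular (S : GradedSystem k A) : Gen 0 (regular S) := by
  intro N hN l
  refine eq_top_iff.2 fun x _ => ?_
  have h1 : (⟨1, S.one_mem_pz⟩ : S.pz 0) ∈ N.carrier 0 := by
    rw [hN 0 le_rfl]; trivial
  have := N.act_mem (zero_add l) h1 x
  convert this
  exact Subtype.ext (one_mul _).symm

lemma Proj.tensor (V : Type) [AddCommGroup V] [Module k V] {F : S.RMod} (hF : Proj F) :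
    Proj (F.tensor V) := by
  intro M N p f hp
  let f' : Hom F (N.homMod V) :=
    ⟨fun l => ((TensorProduct.mk k V (F.X l)).compr₂ (f.f l)).flip,
      fun h x r => LinearMap.ext fun v => f.map_act h (v ⊗ₜ[k] x) r⟩
  let p' : Hom (M.homMod V) (N.homMod V) :=
    ⟨fun l => LinearMap.llcomp k V (M.X l) (N.X l) (p.f l),
      fun h x r => LinearMap.ext fun v => p.map_act h ((show V →ₗ[k] M.X _ from x) v) r⟩
  obtain ⟨φ, hφ⟩ := hF _ _ p' f' (by
    intro l u
    obtain ⟨w, hw⟩ := Module.projective_lifting_property (p.f l) u (hp l)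
    exact ⟨w, hw⟩)
  refine ⟨⟨fun l => TensorProduct.lift (φ.f l).flip, ?_⟩, ?_⟩
  · intro i j l h x r
    change V ⊗[k] _ at x
    induction x with
    | zero => simp
    | tmul v y => exact LinearMap.congr_fun (φ.map_act h y r) v
    | add a b ha hb => simp only [map_add, LinearMap.add_apply, ha, hb]
  · intro l x
    change V ⊗[k] _ at x
    induction x with
    | zero => simp
    | tmul v y => exact LinearMap.congr_fun (hφ l y) v
    | add a b ha hb => simp only [map_add, ha, hb]

lemma Gen.tensor (V : Type) [AddCommGroup V] [Module k V] {g : ℤ} {F : S.RMod} (hF : Gen g F) :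
    Gen g (F.tensor V) := by
  intro N hN l
  let N' : Sub F :=
    { carrier := fun l =>
        { carrier := {x | ∀ v : V, v ⊗ₜ[k] x ∈ N.carrier l}
          add_mem' := fun ha hb v => by
            rw [TensorProduct.tmul_add]; exact add_mem (ha v) (hb v)
          zero_mem' := fun v => by rw [TensorProduct.tmul_zero]; exact zero_mem _
          smul_mem' := fun c x hx v => by
            rw [TensorProduct.tmul_smul]; exact Submodule.smul_mem _ c (hx v) }
      act_mem := fun h x hx r v => N.act_mem h (hx v) r }
  have h := hF N' (fun l hl => eq_top_iff.2 fun x _ v => by rw [hN l hl]; trivial) l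
  refine eq_top_iff.2 fun x _ => ?_
  change V ⊗[k] _ at x
  induction x with
  | zero => exact zero_mem _
  | tmul v y =>
    have hy : y ∈ N'.carrier l := by rw [h]; trivial
    exact hy v
  | add a b ha hb => exact add_mem (ha trivial) (hb trivial)

lemma Proj.shift (s : ℤ) {F : S.RMod} (hF : Proj F) : Proj (F.shift s) := by
  intro M N p f hp
  let f' : Hom F (N.shift (-s)) :=
    ⟨fun l => f.f (l - -s) ∘ₗ (F.tr (show l = l - -s - s by omega)).toLinearMap, by
      intro i j l h x r
      have h1 : i - -s + j = l - -s := by omega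
      have := f.map_act h1 (F.tr (show i = i - -s - s by omega) x) r
      refine Eq.trans ?_ this
      exact congrArg (f.f (l - -s)) (F.tr_act _ _ _ _ x r)⟩
  obtain ⟨φ, hφ⟩ := hF _ _ (p.shift (-s)) f' (fun l => hp _)
  refine ⟨⟨fun l => (M.tr (show l - s - -s = l by omega)).toLinearMap ∘ₗ φ.f (l - s), ?_⟩, ?_⟩
  · intro i j l h x r
    refine Eq.trans (congrArg (M.tr _) (φ.map_act _ x r)) ?_
    exact M.tr_act _ _ _ _ _ r
  · intro l x
    refine (p.map_tr _ _).trans ?_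
    refine (congrArg (N.tr _) (hφ (l - s) x)).trans ?_
    refine (f.map_tr (show l - s - -s = l by omega) _).symm.trans ?_
    congr 1
    refine (Eq.trans ?_ (F.tr_tr (show l - s = l - s - -s - s by omega)
      (show l - s - -s - s = l - s by omega) x))
    have : ∀ {i l : ℤ} (h : i = l) (h' : i - s = l - s) (y : F.X (i - s)),
      (F.shift s).tr h y = F.tr h' y := by
      intro i l h h' y
      subst h; rfl
    exact this _ _ _

lemma Gen.shift (s : ℤ) {g : ℤ} {F : S.RMod} (hF : Gen g F) : Gen (g + s) (F.shift s) := by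
  intro N hN
  let N' : Sub F :=
    { carrier := fun l => (N.carrier (l + s)).comap (F.tr (show l = l + s - s by omega)).toLinearMap
      act_mem := fun {i j l} h x hx r => by
        have := N.act_mem (show i + s + j = l + s by omega) hx r
        rw [Submodule.mem_comap]
        convert this using 1
        exact F.tr_act _ _ _ _ x r }
  have h := hF N' (fun l hl => by
    change Submodule.comap _ (N.carrier (l + s)) = ⊤
    rw [hN (l + s) (by omega), Submodule.comap_top])
  have key : ∀ l, N.carrier (l + s) = ⊤ := by
    intro l
    refine eq_top_iff.2 fun x _ => ?_
    have hx : (F.tr (show l = l + s - s by omega)).symm x ∈ N'.carrier l := by rw [h]; trivial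
    have h2 : (F.tr (show l = l + s - s by omega)) ((F.tr (show l = l + s - s by omega)).symm x) ∈
      N.carrier (l + s) := hx
    rwa [LinearEquiv.apply_symm_apply] at h2
  intro l
  obtain ⟨l', rfl⟩ : ∃ l', l = l' + s := ⟨l - s, by omega⟩
  exact key l'

lemma proj_free (V : Type) [AddCommGroup V] [Module k V] (s : ℤ) : Proj (free S V s) :=
  ((proj_regular S).shift s).tensor V

lemma gen_free (V : Type) [AddCommGroup V] [Module k V] (s : ℤ) : Gen s (free S V s) := by
  simpa using ((gen_regular S).shift s).tensor V

lemma Proj.prod {F F' : S.RMod} (hF : Proj F) (hF' : Proj F') : Proj (F.prod F') := by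
  intro M N p f hp
  obtain ⟨a, ha⟩ := hF M N p ⟨fun l => f.f l ∘ₗ LinearMap.inl k _ _, fun {i j l} h x r => by
    refine Eq.trans ?_ (f.map_act h (x, 0) r)
    exact congrArg (f.f l) (Prod.ext rfl (by
      change 0 = F'.act h 0 r
      simp))⟩ hp
  obtain ⟨b, hb⟩ := hF' M N p ⟨fun l => f.f l ∘ₗ LinearMap.inr k _ _, fun {i j l} h x r => by
    refine Eq.trans ?_ (f.map_act h (0, x) r)
    exact congrArg (f.f l) (Prod.ext (by
      change 0 = F.act h 0 r
      simp) rfl)⟩ hp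
  refine ⟨a.coprod b, fun l x => ?_⟩
  obtain ⟨x, y⟩ := x
  change p.f l (a.f l x + b.f l y) = _
  rw [map_add, ha, hb]
  refine (map_add (f.f l) (x, 0) (0, y)).symm.trans (congrArg (f.f l) ?_)
  exact Prod.ext (add_zero x) (zero_add y)

lemma Gen.prod {g : ℤ} {F F' : S.RMod} (hF : Gen g F) (hF' : Gen g F') : Gen g (F.prod F') := by
  intro N hN l
  let i₁ : Hom F (F.prod F') := ⟨fun l => LinearMap.inl k _ _, fun h x r => Prod.ext rfl (by
      change 0 = F'.act h 0 r
      simp)⟩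
  let i₂ : Hom F' (F.prod F') := ⟨fun l => LinearMap.inr k _ _, fun h x r => Prod.ext (by
      change 0 = F.act h 0 r
      simp) rfl⟩
  have h₁ := hF (N.comap i₁) (fun l hl => eq_top_iff.2 fun x _ => by
    change i₁.f l x ∈ N.carrier l
    rw [hN l hl]; trivial) l
  have h₂ := hF' (N.comap i₂) (fun l hl => eq_top_iff.2 fun x _ => by
    change i₂.f l x ∈ N.carrier l
    rw [hN l hl]; trivial) l
  refine eq_top_iff.2 fun x _ => ?_
  have e₁ : x.1 ∈ (N.comap i₁).carrier l := by rw [h₁]; trivial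
  have e₂ : x.2 ∈ (N.comap i₂).carrier l := by rw [h₂]; trivial
  have := add_mem (S := Submodule k (F.X l × F'.X l)) (s := N.carrier l) e₁ e₂
  have e : (x.1, (0 : F'.X l)) + ((0 : F.X l), x.2) = x :=
    Prod.ext (add_zero x.1) (zero_add x.2)
  exact e ▸ this

lemma proj_of_subsingleton {F : S.RMod} (h : ∀ l, Subsingleton (F.X l)) : Proj F := by
  intro M N p f _
  refine ⟨⟨fun _ => 0, fun _ _ _ => by simp⟩, fun l x => ?_⟩
  rw [Subsingleton.elim x 0]
  simp

lemma gen_of_subsingleton {g : ℤ} {F : S.RMod} (h : ∀ l, Subsingleton (F.X l)) : Gen g F :=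
  fun _ _ _ => Subsingleton.elim _ _

/-! ### Bounded regularity -/

/-- `Reg m g M` says that `M` has a projective resolution whose term in homological degree
`i < m` is generated in degrees `≤ g + i`; equivalently `Tor_i(M, k)` vanishes in degrees
`> g + i` for `i < m`. -/
def Reg : ℕ → ℤ → S.RMod → Prop
  | 0, _, _ => True
  | m + 1, g, M => ∃ (F : S.RMod) (p : Hom F M),
      p.Surj ∧ Proj F ∧ Gen g F ∧ Reg m (g + 1) p.ker.toRMod

/-- Short exact sequences of graded modules. -/
structure SES {M' M M'' : S.RMod} (i : Hom M' M) (q : Hom M M'') : Prop where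
  inj : i.Inj
  surj : q.Surj
  zero : ∀ l y, q.f l (i.f l y) = 0
  exact : ∀ l x, q.f l x = 0 → ∃ y, i.f l y = x

lemma ses_ker {M N : S.RMod} (q : Hom M N) (hq : q.Surj) : SES q.ker.incl q where
  inj _ := Subtype.val_injective
  surj := hq
  zero _ y := y.2
  exact _ x hx := ⟨⟨x, hx⟩, rfl⟩

lemma ses_quot {M : S.RMod} (N : Sub M) : SES N.incl N.mkQ where
  inj _ := Subtype.val_injective
  surj := N.mkQ_surj
  zero l y := (Submodule.Quotient.mk_eq_zero (N.carrier l)).2 y.2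
  exact l x hx := ⟨⟨x, (Submodule.Quotient.mk_eq_zero (N.carrier l)).1 hx⟩, rfl⟩

lemma Reg.mono {m : ℕ} {g g' : ℤ} {M : S.RMod} (h : Reg m g M) (hg : g ≤ g') : Reg m g' M := by
  induction m generalizing g g' M with
  | zero => trivial
  | succ m ih =>
    obtain ⟨F, p, hp, hF, hG, hk⟩ := h
    exact ⟨F, p, hp, hF, hG.mono hg, ih hk (by omega)⟩

lemma Reg.pred {m : ℕ} {g : ℤ} {M : S.RMod} (h : Reg (m + 1) g M) : Reg m g M := by
  induction m generalizing g M with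
  | zero => trivial
  | succ m ih =>
    obtain ⟨F, p, hp, hF, hG, hk⟩ := h
    exact ⟨F, p, hp, hF, hG, ih hk⟩

lemma Reg.congr {m : ℕ} {g : ℤ} {M N : S.RMod} (h : Reg m g M) (e : Hom M N) (hi : e.Inj)
    (hs : e.Surj) : Reg m g N := by
  cases m with
  | zero => trivial
  | succ m =>
    obtain ⟨F, p, hp, hF, hG, hk⟩ := h
    refine ⟨F, e.comp p, fun l => (hs l).comp (hp l), hF, hG, ?_⟩
    have : (e.comp p).ker = p.ker := by
      ext l x
      exact map_eq_zero_iff (e.f l) (hi l)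
    rwa [this]

lemma reg_of_subsingleton (m : ℕ) (g : ℤ) {M : S.RMod} (h : ∀ l, Subsingleton (M.X l)) :
    Reg m g M := by
  induction m generalizing g M with
  | zero => trivial
  | succ m ih =>
    exact ⟨M, Hom.id M, fun _ => surjective_id, proj_of_subsingleton h, gen_of_subsingleton h,
      ih _ fun l => inferInstanceAs (Subsingleton (LinearMap.ker (LinearMap.id : M.X l →ₗ[k] _)))⟩

lemma reg_of_proj (m : ℕ) {g : ℤ} {F : S.RMod} (hF : Proj F) (hG : Gen g F) : Reg m g F := by
  cases m with
  | zero => trivial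
  | succ m =>
    refine ⟨F, Hom.id F, fun _ => surjective_id, hF, hG, reg_of_subsingleton _ _ fun l => ?_⟩
    exact ⟨fun a b => Subtype.ext ((show a.1 = 0 from a.2).trans (show b.1 = 0 from b.2).symm)⟩

/-- Regularity of an extension. -/
lemma SES.reg {M' M M'' : S.RMod} {i : Hom M' M} {q : Hom M M''} (h : SES i q) {m : ℕ} {g : ℤ}
    (h₁ : Reg m g M') (h₂ : Reg m g M'') : Reg m g M := by
  induction m generalizing g M' M M'' with
  | zero => trivial
  | succ m ih =>
    obtain ⟨F', p', hp', hF', hG', hk'⟩ := h₁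
    obtain ⟨F'', p'', hp'', hF'', hG'', hk''⟩ := h₂
    obtain ⟨t, ht⟩ := hF'' M M'' q p'' h.surj
    have hker : ∀ l (x : F'.X l × F''.X l), i.f l (p'.f l x.1) + t.f l x.2 = 0 →
        p''.f l x.2 = 0 := by
      intro l x hx
      have := congrArg (q.f l) hx
      rwa [map_add, h.zero, zero_add, ht, map_zero] at this
    refine ⟨F'.prod F'', (i.comp p').coprod t, ?_, hF'.prod hF'', hG'.prod hG'', ?_⟩
    · intro l x
      obtain ⟨b, hb⟩ := hp'' l (q.f l x)
      obtain ⟨m', hm'⟩ := h.exact l (x - t.f l b) (by rw [map_sub, ht, hb, sub_self])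
      obtain ⟨a, rfl⟩ := hp' l m'
      refine ⟨(a, b), ?_⟩
      change i.f l (p'.f l a) + t.f l b = x
      rw [hm', sub_add_cancel]
    · let K := ((i.comp p').coprod t).ker
      let i' : Hom p'.ker.toRMod K.toRMod := K.codRestrict
        ⟨fun l => LinearMap.inl k _ _ ∘ₗ (p'.ker.carrier l).subtype, fun h x r => Prod.ext rfl (by
          change 0 = F''.act h 0 r
          simp)⟩ (by
          intro l x
          change i.f l (p'.f l x.1) + t.f l 0 = 0
          rw [show p'.f l x.1 = 0 from x.2]
          simp)
      let q' : Hom K.toRMod p''.ker.toRMod := p''.ker.codRestrict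
        ⟨fun l => LinearMap.snd k _ _ ∘ₗ (K.carrier l).subtype, fun h x r => rfl⟩
        (fun l x => hker l x.1 x.2)
      refine ih (i := i') (q := q') ⟨?_, ?_, ?_, ?_⟩ hk' hk''
      · intro l x y hxy
        exact Subtype.ext (congrArg (fun z : K.carrier l => z.1.1) hxy)
      · rintro l ⟨b, hb⟩
        obtain ⟨m', hm'⟩ := h.exact l (t.f l b) (by rw [ht]; exact hb)
        obtain ⟨a, rfl⟩ := hp' l m'
        refine ⟨⟨(-a, b), ?_⟩, rfl⟩
        change i.f l (p'.f l (-a)) + t.f l b = 0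
        rw [map_neg, map_neg, hm', neg_add_cancel]
      · intro l y
        rfl
      · rintro l ⟨⟨a, b⟩, hab⟩ hb
        have hb' : b = 0 := congrArg Subtype.val hb
        subst hb'
        have ha : i.f l (p'.f l a) + t.f l 0 = 0 := hab
        rw [map_zero, add_zero, map_eq_zero_iff _ (h.inj l)] at ha
        exact ⟨⟨a, ha⟩, rfl⟩

/-- Regularity of a quotient. -/
lemma SES.reg_quot {M' M M'' : S.RMod} {i : Hom M' M} {q : Hom M M''} (h : SES i q) {m : ℕ}
    {g : ℤ} (h₁ : Reg m (g + 1) M') (h₂ : Reg (m + 1) g M) : Reg (m + 1) g M'' := by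
  obtain ⟨F, p, hp, hF, hG, hk⟩ := h₂
  refine ⟨F, q.comp p, fun l => (h.surj l).comp (hp l), hF, hG, ?_⟩
  have h₁' : Reg m (g + 1) q.ker.toRMod := by
    refine h₁.congr (q.ker.codRestrict i h.zero) ?_ ?_
    · intro l x y hxy
      exact h.inj l (congrArg Subtype.val hxy)
    · rintro l ⟨x, hx⟩
      obtain ⟨y, rfl⟩ := h.exact l x hx
      exact ⟨y, rfl⟩
  refine SES.reg (M' := p.ker.toRMod) (M'' := q.ker.toRMod)
    (i := (q.comp p).ker.codRestrict p.ker.incl ?_)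
    (q := q.ker.codRestrict (p.comp (q.comp p).ker.incl) fun l x => x.2) ⟨?_, ?_, ?_, ?_⟩ hk h₁'
  · intro l x
    change q.f l (p.f l x.1) = 0
    rw [show p.f l x.1 = 0 from x.2, map_zero]
  · intro l x y hxy
    exact Subtype.ext (congrArg (fun z : (q.comp p).ker.carrier l => z.1) hxy)
  · rintro l ⟨x, hx⟩
    obtain ⟨y, rfl⟩ := hp l x
    exact ⟨⟨y, hx⟩, rfl⟩
  · intro l y
    exact Subtype.ext y.2
  · intro l x hx
    exact ⟨⟨x.1, congrArg Subtype.val hx⟩, rfl⟩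

lemma Reg.of_ker {F M : S.RMod} (p : Hom F M) (hp : p.Surj) {m : ℕ} {g : ℤ} (hF : Proj F)
    (hG : Gen g F) (h : Reg m (g + 1) p.ker.toRMod) : Reg (m + 1) g M :=
  ⟨F, p, hp, hF, hG, h⟩

/-- The syzygy of a module of bounded regularity does not depend on the chosen cover. -/
lemma Reg.ker {M F₀ : S.RMod} {m : ℕ} {g : ℤ} (h : Reg (m + 1) g M) (p₀ : Hom F₀ M)
    (hp₀ : p₀.Surj) (hF₀ : Proj F₀) (hG₀ : Gen g F₀) : Reg m (g + 1) p₀.ker.toRMod := by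
  cases m with
  | zero => trivial
  | succ m =>
    obtain ⟨F, p, hp, hF, hG, hk⟩ := h
    obtain ⟨t, ht⟩ := hF F₀ M p₀ p hp₀
    let np₀ : Hom F₀ M := ⟨fun l => -p₀.f l, fun h x r => by simp [p₀.map_act]⟩
    let P := (p.coprod np₀).ker
    have hP : ∀ l (x : P.carrier l), p.f l x.1.1 = p₀.f l x.1.2 := by
      intro l x
      have : p.f l x.1.1 + -p₀.f l x.1.2 = 0 := x.2
      rwa [← sub_eq_add_neg, sub_eq_zero] at this
    have memP : ∀ l (x : F.X l × F₀.X l), p.f l x.1 = p₀.f l x.2 → x ∈ P.carrier l := by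
      intro l x hx
      change p.f l x.1 + -p₀.f l x.2 = 0
      rw [hx, add_neg_cancel]
    have hPreg : Reg (m + 1) (g + 1) P.toRMod := by
      refine SES.reg (M' := p.ker.toRMod) (M'' := F₀)
        (i := P.codRestrict ⟨fun l => LinearMap.inl k _ _ ∘ₗ (p.ker.carrier l).subtype,
          fun h x r => Prod.ext rfl (by
            change 0 = F₀.act h 0 r
            simp)⟩ (fun l x => memP l _ (by
              change p.f l x.1 = p₀.f l 0
              rw [map_zero]
              exact x.2)))
        (q := ⟨fun l => LinearMap.snd k _ _ ∘ₗ (P.carrier l).subtype, fun h x r => rfl⟩)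
        ⟨?_, ?_, ?_, ?_⟩ hk (reg_of_proj _ hF₀ (hG₀.mono (by omega)))
      · intro l x y hxy
        exact Subtype.ext (congrArg (fun z : P.carrier l => z.1.1) hxy)
      · intro l x
        obtain ⟨y, hy⟩ := hp l (p₀.f l x)
        exact ⟨⟨(y, x), memP l _ hy⟩, rfl⟩
      · intro l y
        rfl
      · rintro l ⟨⟨a, b⟩, hab⟩ hb
        have hb' : b = 0 := hb
        subst hb'
        refine ⟨⟨a, ?_⟩, rfl⟩
        have := hP l ⟨(a, 0), hab⟩
        change p.f l a = p₀.f l 0 at this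
        rwa [map_zero] at this
    refine SES.reg_quot (M' := F) (M := P.toRMod)
      (i := P.codRestrict ⟨fun l => LinearMap.prod LinearMap.id (t.f l), fun h x r =>
        Prod.ext rfl (t.map_act h x r)⟩ (fun l x => memP l _ (ht l x).symm))
      (q := p₀.ker.codRestrict ⟨fun l =>
          (LinearMap.snd k _ _ - t.f l ∘ₗ LinearMap.fst k _ _) ∘ₗ (P.carrier l).subtype, ?_⟩ ?_)
      ⟨?_, ?_, ?_, ?_⟩ (reg_of_proj _ hF (hG.mono (by omega))) hPreg
    · intro i j l h x r
      change F₀.act h x.1.2 r - t.f l (F.act h x.1.1 r) = F₀.act h (x.1.2 - t.f i x.1.1) r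
      rw [t.map_act, map_sub, LinearMap.sub_apply]
    · intro l x
      change p₀.f l (x.1.2 - t.f l x.1.1) = 0
      rw [map_sub, ht, hP, sub_self]
    · intro l x y hxy
      exact congrArg (fun z : P.carrier l => z.1.1) hxy
    · rintro l ⟨x, hx⟩
      refine ⟨⟨(0, x), memP l _ ?_⟩, Subtype.ext ?_⟩
      · change p.f l 0 = p₀.f l x
        rw [map_zero]
        exact hx.symm
      · change x - t.f l 0 = x
        rw [map_zero, sub_zero]
    · intro l y
      exact Subtype.ext (sub_self (t.f l y))
    · rintro l ⟨⟨a, b⟩, hab⟩ hb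
      have hb' : b - t.f l a = 0 := congrArg Subtype.val hb
      exact ⟨a, Subtype.ext (Prod.ext rfl (sub_eq_zero.1 hb').symm)⟩

lemma Reg.tensor (V : Type) [AddCommGroup V] [Module k V] {m : ℕ} {g : ℤ} {M : S.RMod}
    (h : Reg m g M) : Reg m g (M.tensor V) := by
  induction m generalizing g M with
  | zero => trivial
  | succ m ih =>
    obtain ⟨F, p, hp, hF, hG, hk⟩ := h
    refine ⟨F.tensor V, p.tensor V, fun l => LinearMap.lTensor_surjective V (hp l), hF.tensor V,
      hG.tensor V, (ih hk).congr ((p.tensor V).ker.codRestrict (p.ker.incl.tensor V) ?_) ?_ ?_⟩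
    · intro l x
      have := (lTensor_exact V (p.f l).exact_subtype_ker_map (hp l)).apply_apply_eq_zero x
      exact this
    · intro l x y hxy
      exact Module.Flat.lTensor_preserves_injective_linearMap (M := V)
        (LinearMap.ker (p.f l)).subtype Subtype.val_injective (congrArg Subtype.val hxy)
    · rintro l ⟨x, hx⟩
      obtain ⟨y, hy⟩ := (lTensor_exact V (p.f l).exact_subtype_ker_map (hp l) x).1 hx
      exact ⟨y, Subtype.ext hy⟩

lemma Reg.shift (s : ℤ) {m : ℕ} {g : ℤ} {M : S.RMod} (h : Reg m g M) :
    Reg m (g + s) (M.shift s) := by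
  induction m generalizing g M with
  | zero => trivial
  | succ m ih =>
    obtain ⟨F, p, hp, hF, hG, hk⟩ := h
    refine ⟨F.shift s, p.shift s, fun l => hp _, hF.shift s, hG.shift s, ?_⟩
    have := ih hk
    rw [add_right_comm] at this
    exact this

/-! ### Modules concentrated in one degree -/

/-- `T` is concentrated in degree `g`. -/
def Conc (g : ℤ) (T : S.RMod) : Prop := ∀ l ≠ g, Subsingleton (T.X l)

/-- All modules concentrated in a single degree `g` satisfy `Reg m g`. -/
def ConcReg (S : GradedSystem k A) (m : ℕ) : Prop :=
  ∀ (T : S.RMod) (g : ℤ), Conc g T → Reg m g T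

lemma ConcReg.pred {m : ℕ} (h : ConcReg S (m + 1)) : ConcReg S m :=
  fun T g hT => (h T g hT).pred

lemma exists_eq_smul_one (hS : S.ConnectedOne) (r : S.pz 0) :
    ∃ c : k, r = c • (⟨1, S.one_mem_pz⟩ : S.pz 0) := by
  have h : (r : A) ∈ S.piece 0 := le_of_eq (S.pz_natCast 0) r.2
  rw [show S.piece 0 = _ from hS, Submodule.mem_span_singleton] at h
  obtain ⟨c, hc⟩ := h
  exact ⟨c, Subtype.ext hc.symm⟩

lemma Conc.exists_iso (hS : S.ConnectedOne) {g : ℤ} {M T : S.RMod} (hM : Conc g M)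
    (hT : Conc g T) (e : M.X g ≃ₗ[k] T.X g) : ∃ f : Hom M T, f.Inj ∧ f.Surj := by
  classical
  let F : ∀ l, M.X l →ₗ[k] T.X l := fun l =>
    if h : l = g then (T.tr h.symm).toLinearMap ∘ₗ e.toLinearMap ∘ₗ (M.tr h).toLinearMap else 0
  have hF : F g = e.toLinearMap := by
    ext x
    simp [F, tr_rfl]
  refine ⟨⟨F, ?_⟩, ?_, ?_⟩
  · intro i j l h x r
    by_cases hl : l = g
    · by_cases hi : i = g
      · obtain rfl : j = 0 := by omega
        subst hi
        subst hl
        obtain ⟨c, rfl⟩ := exists_eq_smul_one hS r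
        simp only [map_smul, act_one]
      · have := hM i hi
        rw [Subsingleton.elim x 0]
        simp
    · have := hT l hl
      exact Subsingleton.elim _ _
  · intro l
    by_cases hl : l = g
    · subst hl
      change Injective (F l)
      rw [hF]
      exact e.injective
    · have := hM l hl
      exact injective_of_subsingleton _
  · intro l
    by_cases hl : l = g
    · subst hl
      change Surjective (F l)
      rw [hF]
      exact e.surjective
    · have := hT l hl
      exact surjective_to_subsingleton _

lemma concReg_of_reg (hS : S.ConnectedOne) {m : ℕ} {T₀ : S.RMod} (hT₀ : Conc 0 T₀)
    (h1 : Module.finrank k (T₀.X 0) = 1) (h : Reg m 0 T₀) : ConcReg S m := by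
  intro T g hT
  have h2 : Module.finrank k (T₀.X (g - g)) = 1 := by rw [sub_self]; exact h1
  have : Module.Finite k (T₀.X (g - g)) := Module.finite_of_finrank_eq_succ h2
  have e1 : T₀.X (g - g) ≃ₗ[k] k := LinearEquiv.ofFinrankEq _ _ (by rw [h2, Module.finrank_self])
  have hM : Conc g ((T₀.shift g).tensor (T.X g)) := by
    intro l hl
    have : Subsingleton (T₀.X (l - g)) := hT₀ _ (by omega)
    exact inferInstanceAs (Subsingleton (T.X g ⊗[k] T₀.X (l - g)))
  obtain ⟨f, hi, hs⟩ := hM.exists_iso hS hT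
    ((LinearEquiv.lTensor (T.X g) e1).trans (TensorProduct.rid k (T.X g)))
  have := (h.shift g).tensor (T.X g)
  rw [zero_add] at this
  exact this.congr f hi hs

lemma ConcReg.extend {m : ℕ} (hP : ConcReg S m) {g g' : ℤ} (hg : g ≤ g') {N M : S.RMod}
    (f : Hom N M) (hi : f.Inj) (hs : ∀ l ≠ g, Surjective (f.f l)) (h : Reg m g' N) :
    Reg m g' M := by
  refine (ses_quot f.range).reg (h.congr f.toRange ?_ f.toRange_surj) ((hP _ g ?_).mono hg)
  · intro l x y hxy
    exact hi l (congrArg Subtype.val hxy)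
  · intro l hl
    exact Submodule.Quotient.subsingleton_iff.2 (LinearMap.range_eq_top.2 (hs l hl))

lemma ConcReg.extend₂ {m : ℕ} (hP : ConcReg S m) {g : ℤ} {N M : S.RMod}
    (f : Hom N M) (hi : f.Inj) (hs : ∀ l, l ≠ g → l ≠ g + 1 → Surjective (f.f l))
    (h : Reg m (g + 1) N) : Reg m (g + 1) M := by
  classical
  let N' : Sub M :=
    { carrier := fun l => if l ≤ g then LinearMap.range (f.f l) else ⊤
      act_mem := fun {i j l} h x hx r => by
        by_cases hl : l ≤ g
        · by_cases hj : j < 0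
          · rw [M.act_of_neg h hj]
            exact zero_mem _
          · rw [if_pos (by omega)] at hx
            rw [if_pos hl]
            exact f.range.act_mem h hx r
        · rw [if_neg hl]
          trivial }
  have hN' : ∀ l, l ≤ g → N'.carrier l = LinearMap.range (f.f l) := fun l hl => if_pos hl
  have hN'' : ∀ l, ¬ l ≤ g → N'.carrier l = ⊤ := fun l hl => if_neg hl
  have hf : ∀ l x, f.f l x ∈ N'.carrier l := by
    intro l x
    by_cases hl : l ≤ g
    · rw [hN' l hl]
      exact ⟨x, rfl⟩
    · rw [hN'' l hl]
      trivial
  have h1 : Reg m (g + 1) N'.toRMod := by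
    refine hP.extend le_rfl (N'.codRestrict f hf) ?_ ?_ h
    · intro l x y hxy
      exact hi l (congrArg Subtype.val hxy)
    · rintro l hl ⟨x, hx⟩
      have : x ∈ LinearMap.range (f.f l) := by
        by_cases hl' : l ≤ g
        · rwa [hN' l hl'] at hx
        · rw [LinearMap.range_eq_top.2 (hs l (by omega) hl)]
          trivial
      obtain ⟨y, rfl⟩ := this
      exact ⟨y, rfl⟩
  refine hP.extend (by omega : g ≤ g + 1) N'.incl (fun l => Subtype.val_injective) ?_ h1
  intro l hl x
  refine ⟨⟨x, ?_⟩, rfl⟩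
  by_cases hl' : l ≤ g
  · rw [hN' l hl', LinearMap.range_eq_top.2 (hs l hl (by omega))]
    trivial
  · rw [hN'' l hl']
    trivial

/-! ### Complexes -/

/-- Boundaries in a complex of projectives generated in the appropriate degrees, whose homology
in position `p ≥ 1` is concentrated in degrees `p` and `p + 1`. -/
lemma ConcReg.reg_range {K : ℕ → S.RMod} (D : ∀ i, Hom (K (i + 1)) (K i))
    (hK : ∀ i, Proj (K i)) (hG : ∀ i : ℕ, Gen (i : ℤ) (K i))
    (hD : ∀ (i : ℕ) (l : ℤ) (x : (K (i + 1 + 1)).X l), (D i).f l ((D (i + 1)).f l x) = 0)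
    (hex : ∀ (i : ℕ) (l : ℤ), l ≠ i + 1 → l ≠ i + 2 → ∀ x, (D i).f l x = 0 →
      ∃ y, (D (i + 1)).f l y = x)
    {m : ℕ} (hP : ConcReg S m) (p : ℕ) : Reg (m + 1) ((p : ℤ) + 1) (D p).range.toRMod := by
  induction m generalizing p with
  | zero =>
    exact Reg.of_ker (D p).toRange (D p).toRange_surj (hK _) (by exact_mod_cast hG (p + 1)) trivial
  | succ m ih =>
    refine Reg.of_ker (D p).toRange (D p).toRange_surj (hK _) (by exact_mod_cast hG (p + 1)) ?_
    rw [Hom.ker_toRange]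
    have h1 := ih hP.pred (p + 1)
    push_cast at h1
    refine hP.extend₂ ((D p).ker.codRestrict (D (p + 1)).range.incl ?_) ?_ ?_ h1
    · rintro l ⟨_, y, rfl⟩
      exact hD p l y
    · intro l x y hxy
      exact Subtype.ext (congrArg (fun z : (D p).ker.carrier l => z.1) hxy)
    · rintro l h1 h2 ⟨x, hx⟩
      obtain ⟨y, rfl⟩ := hex p l h1 (by omega) x hx
      exact ⟨⟨_, y, rfl⟩, rfl⟩

/-- Boundaries in a complex that is exact in positive positions. -/
lemma reg_range_of_exact {E : ℕ → S.RMod} (d : ∀ i, Hom (E (i + 1)) (E i))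
    (hd : ∀ i l x, (d i).f l x = 0 ↔ ∃ y, (d (i + 1)).f l y = x)
    {m : ℕ} (hE : ∀ p : ℕ, Reg m (p : ℤ) (E p)) (p : ℕ) :
    Reg m ((p : ℤ) + 1) (d p).range.toRMod := by
  induction m generalizing p with
  | zero => trivial
  | succ m ih =>
    refine (ses_ker (d p).toRange (d p).toRange_surj).reg_quot ?_ (by exact_mod_cast hE (p + 1))
    rw [Hom.ker_toRange, show (d p).ker = (d (p + 1)).range by
      ext l x
      exact hd p l x]
    exact_mod_cast ih (fun p => (hE p).pred) (p + 1)

/-! ### Free modules and linear differentials -/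

section Linear

variable {V V' : Type} [AddCommGroup V] [Module k V] [AddCommGroup V'] [Module k V']

lemma piece_eq_pz (S : GradedSystem k A) {d : ℕ} {j : ℤ} (h : j = d) : S.piece d = S.pz j := by
  rw [h, pz_natCast]

/-- The components of a free module. -/
def freeEquiv (S : GradedSystem k A) (V : Type) [AddCommGroup V] [Module k V] {s l : ℤ} {d : ℕ}
    (h : l = s + d) : V ⊗[k] S.piece d ≃ₗ[k] (free S V s).X l :=
  LinearEquiv.lTensor V (LinearEquiv.ofEq _ _ (piece_eq_pz S (show l - s = d by omega)))

lemma subsingleton_pz (S : GradedSystem k A) {j : ℤ} (h : j < 0) : Subsingleton (S.pz j) := by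
  rw [S.pz_of_neg h]
  infer_instance

lemma subsingleton_free (V : Type) [AddCommGroup V] [Module k V] {s l : ℤ} (h : l < s) :
    Subsingleton ((free S V s).X l) := by
  have : Subsingleton (S.pz (l - s)) := subsingleton_pz S (by omega)
  exact inferInstanceAs (Subsingleton (V ⊗[k] S.pz (l - s)))

/-- The components of the homomorphism of free modules given by a matrix of linear forms. -/
def linMap (φ : V' →ₗ[k] V ⊗[k] S.piece 1) (d : ℕ) :
    V' ⊗[k] S.piece d →ₗ[k] V ⊗[k] S.piece (d + 1) :=
  (LinearMap.lTensor V
      ((S.cast (add_comm 1 d)).toLinearMap ∘ₗ TensorProduct.lift (S.mulMap 1 d))) ∘ₗ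
    (TensorProduct.assoc k V (S.piece 1) (S.piece d)).toLinearMap ∘ₗ
    (LinearMap.rTensor (S.piece d) φ)

/-- The homomorphism of free modules given by a matrix of linear forms. -/
def linHom (φ : V' →ₗ[k] V ⊗[k] S.piece 1) {s s' : ℤ} (h : s' = s + 1) :
    Hom (free S V' s') (free S V s) :=
  freeLift ((freeEquiv S V (d := 1) (by rw [h]; rfl)).toLinearMap ∘ₗ φ)

lemma linHom_freeEquiv (φ : V' →ₗ[k] V ⊗[k] S.piece 1) {s s' : ℤ} (h : s' = s + 1) {l : ℤ} {d : ℕ}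
    (hl : l = s' + d) (hl' : l = s + (d + 1 : ℕ)) (x : V' ⊗[k] S.piece d) :
    (linHom φ h).f l (freeEquiv S V' hl x) = freeEquiv S V hl' (linMap φ d x) := by
  induction x with
  | zero => simp
  | add a b ha hb => simp only [map_add, ha, hb]
  | tmul v r =>
    change (free S V s).act _
      (freeEquiv S V (d := 1) (show s' = s + ((1 : ℕ) : ℤ) by rw [h]; rfl) (φ v)) _ =
      freeEquiv S V hl' (LinearMap.lTensor V _ (TensorProduct.assoc k V _ _ (φ v ⊗ₜ[k] r)))
    generalize φ v = y
    induction y with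
    | zero => simp
    | add a b ha hb => simp only [map_add, LinearMap.add_apply, TensorProduct.add_tmul, ha, hb]
    | tmul w a => rfl

end Linear
/-! ### Linear complexes of free modules -/

section Complexes

variable (n : ℕ → ℕ)
  (φ : ∀ i : ℕ, (Fin (n (i + 1)) → k) →ₗ[k] ((Fin (n i) → k) ⊗[k] S.piece 1))

/-- The differentials of a linear complex of free modules. -/
def cx (i : ℕ) : Hom (free S (Fin (n (i + 1)) → k) (i + 1 : ℕ)) (free S (Fin (n i) → k) (i : ℕ)) :=
  linHom (φ i) (by push_cast; rfl)

lemma cx_freeEquiv (i : ℕ) {l : ℤ} {d : ℕ} (hl : l = (i + 1 : ℕ) + d) (hl' : l = i + (d + 1 : ℕ))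
    (x : (Fin (n (i + 1)) → k) ⊗[k] S.piece d) :
    (cx n φ i).f l (freeEquiv S _ hl x) = freeEquiv S _ hl' (S.Dmap n φ i d x) :=
  linHom_freeEquiv (φ i) _ hl hl' x

variable {n φ}

lemma cx_cx (h : ∀ i d : ℕ, (S.Dmap n φ i (d + 1)) ∘ₗ (S.Dmap n φ (i + 1) d) = 0) (i : ℕ) (l : ℤ)
    (x : (free S (Fin (n (i + 1 + 1)) → k) (i + 1 + 1 : ℕ)).X l) :
    (cx n φ i).f l ((cx n φ (i + 1)).f l x) = 0 := by
  by_cases hl : l < (i + 1 + 1 : ℕ)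
  · have := subsingleton_free (S := S) (Fin (n (i + 1 + 1)) → k) hl
    rw [Subsingleton.elim x 0]
    simp
  · obtain ⟨d, hd⟩ := Int.eq_ofNat_of_zero_le (sub_nonneg.2 (not_lt.1 hl))
    have h1 : l = (i + 1 + 1 : ℕ) + (d : ℤ) := by omega
    obtain ⟨y, rfl⟩ := (freeEquiv S _ h1).surjective x
    rw [cx_freeEquiv n φ (i + 1) h1 (by push_cast at h1 ⊢; omega),
      cx_freeEquiv n φ i _ (by push_cast at h1 ⊢; omega)]
    have := LinearMap.congr_fun (h i d) y
    rw [LinearMap.comp_apply] at this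
    rw [this]
    simp

lemma cx_exact_at {i d : ℕ}
    (h : LinearMap.ker (S.Dmap n φ i (d + 1)) ≤ LinearMap.range (S.Dmap n φ (i + 1) d))
    {l : ℤ} (hl : l = (i + 1 : ℕ) + (d + 1 : ℕ)) {x : (free S (Fin (n (i + 1)) → k) (i + 1 : ℕ)).X l}
    (hx : (cx n φ i).f l x = 0) : ∃ y, (cx n φ (i + 1)).f l y = x := by
  obtain ⟨y, rfl⟩ := (freeEquiv S _ hl).surjective x
  rw [cx_freeEquiv n φ i hl (by push_cast at hl ⊢; omega), LinearEquiv.map_eq_zero_iff] at hx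
  obtain ⟨z, rfl⟩ := h hx
  exact ⟨_, cx_freeEquiv n φ (i + 1) (by push_cast at hl ⊢; omega) hl z⟩

lemma cx_inj_at {i : ℕ} (h : Injective (S.Dmap n φ i 0))
    {l : ℤ} (hl : l = (i + 1 : ℕ) + (0 : ℕ)) {x : (free S (Fin (n (i + 1)) → k) (i + 1 : ℕ)).X l}
    (hx : (cx n φ i).f l x = 0) : x = 0 := by
  obtain ⟨y, rfl⟩ := (freeEquiv S _ hl).surjective x
  rw [cx_freeEquiv n φ i hl (by push_cast at hl ⊢; omega), LinearEquiv.map_eq_zero_iff] at hx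
  rw [h (hx.trans (map_zero _).symm), map_zero]

/-- Boundaries in an almost exact linear complex. -/
lemma ConcReg.reg_range_cx (hc : ∀ i d : ℕ, (S.Dmap n φ i (d + 1)) ∘ₗ (S.Dmap n φ (i + 1) d) = 0)
    (hex : ∀ i d : ℕ,
      LinearMap.ker (S.Dmap n φ i (d + 2)) ≤ LinearMap.range (S.Dmap n φ (i + 1) (d + 1)))
    {m : ℕ} (hP : ConcReg S m) : Reg (m + 1) 1 (cx n φ 0).range.toRMod := by
  refine ConcReg.reg_range (K := fun i => free S (Fin (n i) → k) (i : ℕ)) (cx n φ)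
    (fun i => proj_free _ _) (fun i => gen_free _ _) (cx_cx hc) ?_ hP 0
  intro i l h1 h2 x hx
  by_cases hl : l < (i + 1 : ℕ)
  · have := subsingleton_free (S := S) (Fin (n (i + 1)) → k) hl
    exact ⟨0, Subsingleton.elim _ _⟩
  · obtain ⟨d, hd⟩ := Int.eq_ofNat_of_zero_le (show 0 ≤ l - (i + 3) by push_cast at hl; omega)
    exact cx_exact_at (hex i d) (by push_cast; omega) hx

end Complexes

/-! ### Restriction along a homomorphism of graded algebras -/

section Restrict

variable {B : Type} [Ring B] [Algebra k B] {R : GradedSystem k B}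

/-- Homomorphisms of graded algebras, with components extended by zero. -/
structure GHom (R : GradedSystem k B) (S : GradedSystem k A) where
  f : ∀ j : ℤ, R.pz j →ₗ[k] S.pz j
  map_one : (f 0 ⟨1, R.one_mem_pz⟩ : A) = 1
  map_mul : ∀ {i j l : ℤ} (h : i + j = l) (x : R.pz i) (y : R.pz j),
    (f l ⟨x.1 * y.1, R.mul_mem_pz h x.2 y.2⟩ : A) = f i x * f j y

/-- Restriction of scalars. -/
abbrev restrict (θ : GHom R S) (M : S.RMod) : R.RMod where
  X := M.X
  act {i j l} h := (M.act h).compl₂ (θ.f j)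
  act_one h x := by
    rw [LinearMap.compl₂_apply, show θ.f 0 ⟨1, R.one_mem_pz⟩ = ⟨1, S.one_mem_pz⟩ from
      Subtype.ext θ.map_one, M.act_one]
  act_act h h' hq h'' x r r' := by
    simp only [LinearMap.compl₂_apply]
    rw [M.act_act h h' hq h'']
    exact congrArg _ (Subtype.ext (θ.map_mul hq r r').symm)

/-- Restriction of scalars on homomorphisms. -/
def Hom.restrict (θ : GHom R S) {M N : S.RMod} (f : Hom M N) :
    Hom (M.restrict θ) (N.restrict θ) where
  f := f.f
  map_act h x r := f.map_act h x (θ.f _ r)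

lemma reg_restrict_free (θ : GHom R S) {m : ℕ} (h : Reg m 0 ((regular S).restrict θ)) (V : Type)
    [AddCommGroup V] [Module k V] (s : ℤ) : Reg m s ((free S V s).restrict θ) := by
  have := (h.shift s).tensor V
  rw [zero_add] at this
  exact this.congr ⟨fun l => LinearMap.id, fun h x r => rfl⟩ (fun l => injective_id)
    (fun l => surjective_id)

variable (π : ∀ n : ℕ, (R.piece n : Type) →ₗ[k] S.piece n)

lemma coe_pieces_congr {m n : ℕ} (h : m = n) (x : R.piece m) (y : R.piece n)
    (hxy : (x : B) = y) : (π m x : A) = π n y := by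
  subst h
  rw [Subtype.ext hxy]

/-- The extension by zero of a family of maps of graded components. -/
def extPieces (j : ℤ) : R.pz j →ₗ[k] S.pz j :=
  if h : 0 ≤ j then
    (LinearEquiv.ofEq _ _ (piece_eq_pz S (Int.toNat_of_nonneg h).symm)).toLinearMap ∘ₗ
      π j.toNat ∘ₗ (LinearEquiv.ofEq _ _ (piece_eq_pz R (Int.toNat_of_nonneg h).symm).symm).toLinearMap
  else 0

lemma coe_extPieces {n : ℕ} {j : ℤ} (h : j = n) (x : R.pz j) (y : R.piece n)
    (hxy : (x : B) = y) : (extPieces π j x : A) = π n y := by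
  subst h
  rw [extPieces, dif_pos (by omega)]
  exact coe_pieces_congr π (by omega) _ _ hxy

/-- The homomorphism of graded algebras given by its components. -/
def GHom.ofPieces (hπ_one : ((π 0 ⟨1, R.one_mem⟩ : S.piece 0) : A) = 1)
    (hπ_mul : ∀ (m n : ℕ) (x : R.piece m) (y : R.piece n),
      π (m + n) (R.mulMap m n x y) = S.mulMap m n (π m x) (π n y)) : GHom R S where
  f := extPieces π
  map_one := (coe_extPieces π (n := 0) rfl _ ⟨1, R.one_mem⟩ rfl).trans hπ_one
  map_mul {i j l} h x y := by
    by_cases hi : i < 0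
    · have := subsingleton_pz R hi
      have h0 : (⟨x.1 * y.1, R.mul_mem_pz h x.2 y.2⟩ : R.pz l) = 0 := by
        rw [Subsingleton.elim x 0]
        exact Subtype.ext (zero_mul _)
      rw [h0, Subsingleton.elim x 0]
      simp
    by_cases hj : j < 0
    · have := subsingleton_pz R hj
      have h0 : (⟨x.1 * y.1, R.mul_mem_pz h x.2 y.2⟩ : R.pz l) = 0 := by
        rw [Subsingleton.elim y 0]
        exact Subtype.ext (mul_zero _)
      rw [h0, Subsingleton.elim y 0]
      simp
    obtain ⟨a, rfl⟩ := Int.eq_ofNat_of_zero_le (not_lt.1 hi)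
    obtain ⟨b, rfl⟩ := Int.eq_ofNat_of_zero_le (not_lt.1 hj)
    have hx : (x : B) ∈ R.piece a := R.pz_natCast a ▸ x.2
    have hy : (y : B) ∈ R.piece b := R.pz_natCast b ▸ y.2
    rw [coe_extPieces π rfl x ⟨x, hx⟩ rfl, coe_extPieces π rfl y ⟨y, hy⟩ rfl,
      coe_extPieces π (n := a + b) (by push_cast; exact h.symm) _ (R.mulMap a b ⟨x, hx⟩ ⟨y, hy⟩) rfl,
      hπ_mul]
    rfl

end Restrict
/-! ### Modules concentrated in one degree over an almost linearly resolved algebra -/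

lemma int_cases (l : ℤ) : l < 0 ∨ l = 0 ∨ ∃ d : ℕ, l = (d + 1 : ℕ) := by
  rcases lt_trichotomy l 0 with h | h | h
  · exact Or.inl h
  · exact Or.inr (Or.inl h)
  · exact Or.inr (Or.inr ⟨(l - 1).toNat, by omega⟩)

lemma conc_quot {V : Type} [AddCommGroup V] [Module k V] {N : Sub (free S V (0 : ℕ))}
    (hN : ∀ d : ℕ, N.carrier (d + 1 : ℕ) = ⊤) : Conc 0 N.quot := by
  intro l hl
  refine Submodule.Quotient.subsingleton_iff.2 ?_
  rcases int_cases l with h | h | ⟨d, rfl⟩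
  · have := subsingleton_free (S := S) V (s := (0 : ℕ)) (l := l) h
    exact Subsingleton.elim _ _
  · exact absurd h hl
  · exact hN d

lemma finrank_quot (hS : S.ConnectedOne) [Nontrivial A] {n : ℕ} (hn : n = 1)
    {N : Sub (free S (Fin n → k) (0 : ℕ))} (hN : N.carrier 0 = ⊥) :
    Module.finrank k (N.quot.X 0) = 1 := by
  have h0 : Module.finrank k (S.piece 0) = 1 := by
    rw [show S.piece 0 = _ from hS]
    exact finrank_span_singleton one_ne_zero
  have h1 := (freeEquiv S (Fin n → k) (s := (0 : ℕ)) (l := 0) (d := 0) rfl).finrank_eq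
  rw [Module.finrank_tensorProduct, h0, Module.finrank_fin_fun, hn] at h1
  change Module.finrank k (_ ⧸ N.carrier 0) = 1
  rw [hN, (Submodule.quotEquivOfEqBot ⊥ rfl).finrank_eq]
  subst hn
  exact h1.symm

lemma range_cx_zero (n : ℕ → ℕ)
    (φ : ∀ i : ℕ, (Fin (n (i + 1)) → k) →ₗ[k] ((Fin (n i) → k) ⊗[k] S.piece 1)) {l : ℤ}
    (hl : l ≤ 0) : (cx n φ 0).range.carrier l = ⊥ := by
  have := subsingleton_free (S := S) (Fin (n 1) → k) (s := (0 + 1 : ℕ)) (l := l)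
    (by push_cast; omega)
  refine eq_bot_iff.2 ?_
  rintro _ ⟨y, rfl⟩
  rw [Subsingleton.elim y 0]
  simp

lemma mem_range_cx {n : ℕ → ℕ}
    {φ : ∀ i : ℕ, (Fin (n (i + 1)) → k) →ₗ[k] ((Fin (n i) → k) ⊗[k] S.piece 1)} {i d : ℕ} {l : ℤ}
    (hl : l = i + (d + 1 : ℕ)) (x : (Fin (n i) → k) ⊗[k] S.piece (d + 1)) :
    freeEquiv S _ hl x ∈ (cx n φ i).range.carrier l ↔ x ∈ LinearMap.range (S.Dmap n φ i d) := by
  constructor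
  · rintro ⟨y, hy⟩
    obtain ⟨z, rfl⟩ := (freeEquiv S _ (show l = (i + 1 : ℕ) + (d : ℤ) by
      push_cast at hl ⊢; omega)).surjective y
    rw [cx_freeEquiv n φ i _ hl] at hy
    exact ⟨z, (freeEquiv S _ hl).injective hy⟩
  · rintro ⟨z, rfl⟩
    exact ⟨_, cx_freeEquiv n φ i (by push_cast at hl ⊢; omega) hl z⟩

section Restrict

variable {B : Type} [Ring B] [Algebra k B] {R : GradedSystem k B}

lemma concReg_of_reg_restrict [Nontrivial A] (hR : R.ConnectedOne) (hS : S.IsKoszul)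
    (θ : GHom R S) {m : ℕ} (h : Reg m 0 ((regular S).restrict θ)) : ConcReg R m := by
  obtain ⟨hS0, w, χ, hw, hsurj, hinj, hex⟩ := hS
  have hE : ∀ p : ℕ, Reg m (p : ℤ) ((free S (Fin (w p) → k) (p : ℕ)).restrict θ) :=
    fun p => reg_restrict_free θ h _ _
  have hd : ∀ (i : ℕ) (l : ℤ) (x : (free S (Fin (w (i + 1)) → k) (i + 1 : ℕ)).X l),
      (cx w χ i).f l x = 0 ↔ ∃ y, (cx w χ (i + 1)).f l y = x := by
    intro i l x
    constructor
    · intro hx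
      by_cases hl : l < (i + 1 : ℕ)
      · have := subsingleton_free (S := S) (Fin (w (i + 1)) → k) hl
        exact ⟨0, Subsingleton.elim _ _⟩
      by_cases hl' : l = (i + 1 : ℕ)
      · refine ⟨0, ?_⟩
        rw [map_zero, cx_inj_at (hinj i) (by rw [hl']; push_cast; omega) hx]
      · obtain ⟨d, hd⟩ := Int.eq_ofNat_of_zero_le (show 0 ≤ l - (i + 2) by
          push_cast at hl hl'; omega)
        exact cx_exact_at (hex i d).ge (by push_cast; omega) hx
    · rintro ⟨y, rfl⟩
      refine cx_cx (fun i d => ?_) i l y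
      exact LinearMap.ext fun z => (hex i d).le ⟨z, rfl⟩
  have hr := reg_range_of_exact (E := fun p => (free S (Fin (w p) → k) (p : ℕ)).restrict θ)
    (fun i => (cx w χ i).restrict θ) hd hE 0
  have hT : Reg m 0 ((cx w χ 0).range.quot.restrict θ) := by
    cases m with
    | zero => trivial
    | succ m =>
      exact ((ses_quot ((cx w χ 0).restrict θ).range).reg_quot hr.pred (hE 0)).congr
        ⟨fun l => LinearMap.id, fun h x r => by
          obtain ⟨y, rfl⟩ := Submodule.mkQ_surjective _ x
          rfl⟩ (fun l => injective_id) (fun l => surjective_id)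
  refine concReg_of_reg hR (T₀ := (cx w χ 0).range.quot.restrict θ) ?_ ?_ hT
  · refine conc_quot (S := S) fun d => eq_top_iff.2 fun x _ => ?_
    have hl : ((d + 1 : ℕ) : ℤ) = (0 : ℕ) + (d + 1 : ℕ) := by simp
    obtain ⟨y, rfl⟩ := (freeEquiv S _ hl).surjective x
    exact (mem_range_cx hl y).2 (hsurj d y)
  · exact finrank_quot hS0 hw (range_cx_zero w χ le_rfl)

end Restrict
/-- The coordinate of a one-dimensional space of tuples. -/
def oneCoord (k : Type) [Field k] {m : ℕ} (h : m = 1) : (Fin m → k) ≃ₗ[k] k :=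
  (LinearEquiv.funCongrLeft k k (finCongr h.symm)).trans (LinearEquiv.funUnique (Fin 1) k k)

lemma oneTensorEquiv_tmul {m : ℕ} (h : m = 1) {M : Type} [AddCommGroup M] [Module k M]
    (v : Fin m → k) (x : M) : oneTensorEquiv h M (v ⊗ₜ[k] x) = oneCoord k h v • x := rfl

lemma mem_map_oneTensorEquiv {m : ℕ} (h : m = 1) {M : Type} [AddCommGroup M] [Module k M]
    (N : Submodule k ((Fin m → k) ⊗[k] M)) (x : (Fin m → k) ⊗[k] M) :
    oneTensorEquiv h M x ∈ N.map (oneTensorEquiv h M).toLinearMap ↔ x ∈ N :=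
  (oneTensorEquiv h M).injective.mem_set_image

section Restrict

variable {B : Type} [Ring B] [Algebra k B] {R : GradedSystem k B}

/-- The projection from a free module of rank one to a factor algebra. -/
def factorHom (θ : GHom R S) {m : ℕ} (h : m = 1) :
    Hom (free R (Fin m → k) (0 : ℕ)) ((regular S).restrict θ) :=
  freeLift (LinearMap.toSpanSingleton k (S.pz 0) ⟨1, S.one_mem_pz⟩ ∘ₗ (oneCoord k h).toLinearMap)

lemma factorHom_freeEquiv {π : ∀ n : ℕ, (R.piece n : Type) →ₗ[k] S.piece n}
    (hπ_one : ((π 0 ⟨1, R.one_mem⟩ : S.piece 0) : A) = 1)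
    (hπ_mul : ∀ (m n : ℕ) (x : R.piece m) (y : R.piece n),
      π (m + n) (R.mulMap m n x y) = S.mulMap m n (π m x) (π n y))
    {m : ℕ} (h : m = 1) {l : ℤ} {d : ℕ} (hl : l = (0 : ℕ) + (d : ℤ))
    (x : (Fin m → k) ⊗[k] R.piece d) :
    ((((factorHom (GHom.ofPieces π hπ_one hπ_mul) h).f l (freeEquiv R _ hl x) : S.pz l)) : A) =
      π d (oneTensorEquiv h _ x) := by
  induction x with
  | zero => simp
  | add a b ha hb =>
    rw [map_add, map_add, map_add, map_add]
    exact congrArg₂ (· + ·) ha hb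
  | tmul v r =>
    rw [oneTensorEquiv_tmul, map_smul]
    change (oneCoord k h v • (1 : A)) * (extPieces π _ _ : A) = oneCoord k h v • (π d r : A)
    rw [smul_one_mul]
    congr 1
    exact coe_extPieces π (by omega) _ r rfl

variable {π : ∀ n : ℕ, (R.piece n : Type) →ₗ[k] S.piece n}

lemma factorHom_surj (hπ_surj : ∀ n : ℕ, Surjective (π n))
    (hπ_one : ((π 0 ⟨1, R.one_mem⟩ : S.piece 0) : A) = 1)
    (hπ_mul : ∀ (m n : ℕ) (x : R.piece m) (y : R.piece n),
      π (m + n) (R.mulMap m n x y) = S.mulMap m n (π m x) (π n y)) {m : ℕ} (h : m = 1) :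
    (factorHom (GHom.ofPieces π hπ_one hπ_mul) h).Surj := by
  intro l y
  by_cases hl : l < 0
  · have := subsingleton_pz S hl
    exact ⟨0, Subsingleton.elim (α := S.pz l) _ _⟩
  obtain ⟨d, rfl⟩ := Int.eq_ofNat_of_zero_le (not_lt.1 hl)
  obtain ⟨r, hr⟩ := hπ_surj d ⟨y.1, (S.pz_natCast d) ▸ y.2⟩
  obtain ⟨x, rfl⟩ := (oneTensorEquiv (k := k) h (R.piece d)).surjective r
  refine ⟨freeEquiv R _ (show (d : ℤ) = (0 : ℕ) + (d : ℤ) by simp) x, Subtype.ext ?_⟩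
  rw [factorHom_freeEquiv hπ_one hπ_mul h _ x, hr]

lemma ker_factorHom [Nontrivial A] (hR : R.ConnectedOne)
    (hπ_one : ((π 0 ⟨1, R.one_mem⟩ : S.piece 0) : A) = 1)
    (hπ_mul : ∀ (m n : ℕ) (x : R.piece m) (y : R.piece n),
      π (m + n) (R.mulMap m n x y) = S.mulMap m n (π m x) (π n y))
    {n : ℕ → ℕ}
    {φ : ∀ i : ℕ, (Fin (n (i + 1)) → k) →ₗ[k] ((Fin (n i) → k) ⊗[k] R.piece 1)}
    (hn0 : n 0 = 1)
    (hH0 : ∀ d : ℕ,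
      Submodule.map (oneTensorEquiv hn0 (R.piece (d + 1) : Type)).toLinearMap
          (LinearMap.range (R.Dmap n φ 0 d)) = LinearMap.ker (π (d + 1))) :
    (factorHom (GHom.ofPieces π hπ_one hπ_mul) hn0).ker = (cx n φ 0).range := by
  ext l x
  rcases int_cases l with hl | rfl | ⟨d, rfl⟩
  · have := subsingleton_free (S := R) (Fin (n 0) → k) (s := (0 : ℕ)) (l := l) hl
    rw [Subsingleton.elim x 0]
    exact iff_of_true (zero_mem _) (zero_mem _)
  · rw [range_cx_zero n φ le_rfl]
    have hl : (0 : ℤ) = (0 : ℕ) + ((0 : ℕ) : ℤ) := rfl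
    obtain ⟨y, rfl⟩ := (freeEquiv R _ hl).surjective x
    refine Iff.trans Subtype.ext_iff ?_
    rw [factorHom_freeEquiv hπ_one hπ_mul hn0 hl y, Submodule.mem_bot,
      LinearEquiv.map_eq_zero_iff, ← (oneTensorEquiv hn0 _).map_eq_zero_iff]
    generalize oneTensorEquiv hn0 _ y = r
    have h1 : (r : B) ∈ Submodule.span k {(1 : B)} := hR ▸ r.2
    obtain ⟨c, hc⟩ := Submodule.mem_span_singleton.1 h1
    obtain rfl : r = c • ⟨1, R.one_mem⟩ := Subtype.ext hc.symm
    rw [map_smul]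
    change c • ((π 0 ⟨1, R.one_mem⟩ : S.piece 0) : A) = 0 ↔ _
    rw [hπ_one, smul_eq_zero_iff_left one_ne_zero]
    constructor
    · rintro rfl
      exact zero_smul _ _
    · intro h
      have h2 := congrArg (π 0) h
      rw [map_smul, map_zero] at h2
      have h3 : c • ((π 0 ⟨1, R.one_mem⟩ : S.piece 0) : A) = 0 := congrArg Subtype.val h2
      rwa [hπ_one, smul_eq_zero_iff_left one_ne_zero] at h3
  · have hl : ((d + 1 : ℕ) : ℤ) = (0 : ℕ) + ((d + 1 : ℕ) : ℤ) := by simp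
    obtain ⟨y, rfl⟩ := (freeEquiv R _ hl).surjective x
    rw [mem_range_cx hl y]
    refine Iff.trans Subtype.ext_iff ?_
    rw [factorHom_freeEquiv hπ_one hπ_mul hn0 hl y]
    refine Iff.trans ?_ (mem_map_oneTensorEquiv hn0 _ y)
    rw [hH0 d, LinearMap.mem_ker]
    exact Subtype.ext_iff.symm

end Restrict
section Restrict

variable {B : Type} [Ring B] [Algebra k B] {R : GradedSystem k B}
  {π : ∀ n : ℕ, (R.piece n : Type) →ₗ[k] S.piece n}

lemma concReg_of_almost_resolution (hR : R.ConnectedOne) (hS : S.IsKoszul)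
    (hπ_surj : ∀ n : ℕ, Surjective (π n))
    (hπ_one : ((π 0 ⟨1, R.one_mem⟩ : S.piece 0) : A) = 1)
    (hπ_mul : ∀ (m n : ℕ) (x : R.piece m) (y : R.piece n),
      π (m + n) (R.mulMap m n x y) = S.mulMap m n (π m x) (π n y))
    {n : ℕ → ℕ}
    {φ : ∀ i : ℕ, (Fin (n (i + 1)) → k) →ₗ[k] ((Fin (n i) → k) ⊗[k] R.piece 1)}
    (hn0 : n 0 = 1)
    (hcomplex : ∀ i d : ℕ, (R.Dmap n φ i (d + 1)) ∘ₗ (R.Dmap n φ (i + 1) d) = 0)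
    (hH0 : ∀ d : ℕ,
      Submodule.map (oneTensorEquiv hn0 (R.piece (d + 1) : Type)).toLinearMap
          (LinearMap.range (R.Dmap n φ 0 d)) = LinearMap.ker (π (d + 1)))
    (hHp : ∀ i d : ℕ,
      LinearMap.ker (R.Dmap n φ i (d + 2)) ≤ LinearMap.range (R.Dmap n φ (i + 1) (d + 1)))
    (m : ℕ) : ConcReg R m := by
  induction m with
  | zero => exact fun _ _ _ => trivial
  | succ m ih =>
    have hr := (ih.reg_range_cx hcomplex hHp).pred
    rcases subsingleton_or_nontrivial A with hA | hA
    · rcases subsingleton_or_nontrivial B with hB | hB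
      · intro T g _
        refine reg_of_subsingleton _ _ fun l => ⟨fun x y => ?_⟩
        have : ∀ x : T.X l, x = 0 := fun x => by
          rw [← T.act_one (add_zero l) x, Subsingleton.elim (⟨1, R.one_mem_pz⟩ : R.pz 0) 0,
            map_zero]
        rw [this x, this y]
      · refine concReg_of_reg hR (T₀ := (cx n φ 0).range.quot) ?_ ?_ ?_
        · refine conc_quot fun d => eq_top_iff.2 fun x _ => ?_
          have hl : ((d + 1 : ℕ) : ℤ) = (0 : ℕ) + (d + 1 : ℕ) := by simp
          obtain ⟨y, rfl⟩ := (freeEquiv R _ hl).surjective x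
          refine (mem_range_cx hl y).2 ((mem_map_oneTensorEquiv hn0 _ y).1 ?_)
          rw [hH0 d]
          exact Subsingleton.elim _ _
        · exact finrank_quot hR hn0 (range_cx_zero n φ le_rfl)
        · refine Reg.of_ker (cx n φ 0).range.mkQ (Sub.mkQ_surj _) (proj_free _ _) (gen_free _ _) ?_
          rw [Sub.ker_mkQ]
          exact hr
    · refine concReg_of_reg_restrict hR hS (GHom.ofPieces π hπ_one hπ_mul) ?_
      refine Reg.of_ker _ (factorHom_surj hπ_surj hπ_one hπ_mul hn0) (proj_free _ _)
        (gen_free _ _) ?_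
      rw [ker_factorHom hR hπ_one hπ_mul hn0 hH0]
      exact hr

end Restrict

/-! ### Extraction of linear resolutions -/

/-- A graded submodule of a finitely generated free module in degree `i`, admitting a linear
resolution starting in degree `i + 1`. -/
structure Syz (S : GradedSystem k A) (i : ℕ) where
  n : ℕ
  L : Sub (free S (Fin n → k) (i : ℕ))
  low : ∀ l : ℤ, l ≤ i → L.carrier l = ⊥
  reg : ∀ m, Reg m (i + 1) L.toRMod

/-- `Z'` and `ψ` form a presentation of the graded module underlying `Z`. -/
def Syz.Covers {i : ℕ} (Z : Syz S i) (Z' : Syz S (i + 1))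
    (ψ : (Fin Z'.n → k) →ₗ[k] (Fin Z.n → k) ⊗[k] S.piece 1) : Prop :=
  (∀ d : ℕ, ∀ x, freeEquiv S _ (l := i + (d + 1 : ℕ)) rfl x ∈ Z.L.carrier _ ↔
    x ∈ LinearMap.range (linMap ψ d)) ∧
  Injective (linMap ψ 0) ∧
  ∀ d : ℕ, ∀ x, freeEquiv S _ (l := (i + 1 : ℕ) + (d + 1 : ℕ)) rfl x ∈ Z'.L.carrier _ ↔
    linMap ψ (d + 1) x = 0

lemma Gen.hom_surj {g : ℤ} {M N : S.RMod} (hN : Gen g N) (p : Hom M N)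
    (hp : ∀ l ≤ g, Surjective (p.f l)) : p.Surj :=
  fun l => LinearMap.range_eq_top.1 (hN p.range (fun l hl => LinearMap.range_eq_top.2 (hp l hl)) l)

lemma Reg.gen {g : ℤ} {M : S.RMod} (h : Reg 1 g M) : Gen g M := by
  obtain ⟨F, p, hp, -, hG, -⟩ := h
  intro N hN l
  refine eq_top_iff.2 fun x _ => ?_
  obtain ⟨y, rfl⟩ := hp l x
  have h1 := hG (N.comap p) (fun l hl => by
    change (N.carrier l).comap _ = ⊤
    rw [hN l hl, Submodule.comap_top]) l
  have : y ∈ (N.comap p).carrier l := by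
    rw [h1]
    trivial
  exact this

lemma exists_eq_tmul_one {V' : Type} [AddCommGroup V'] [Module k V']
    (hS : S.ConnectedOne) (x : V' ⊗[k] S.piece 0) : ∃ v : V', x = v ⊗ₜ ⟨1, S.one_mem⟩ := by
  induction x with
  | zero => exact ⟨0, (TensorProduct.zero_tmul _ _).symm⟩
  | add a b ha hb =>
    obtain ⟨v, rfl⟩ := ha
    obtain ⟨w, rfl⟩ := hb
    exact ⟨v + w, (TensorProduct.add_tmul _ _ _).symm⟩
  | tmul v r =>
    have h1 : (r : A) ∈ Submodule.span k {(1 : A)} := hS ▸ r.2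
    obtain ⟨c, hc⟩ := Submodule.mem_span_singleton.1 h1
    obtain rfl : r = c • ⟨1, S.one_mem⟩ := Subtype.ext hc.symm
    exact ⟨c • v, by rw [TensorProduct.smul_tmul]⟩

lemma linMap_zero_tmul_one {V V' : Type} [AddCommGroup V] [Module k V] [AddCommGroup V']
    [Module k V'] (φ : V' →ₗ[k] V ⊗[k] S.piece 1) (v : V') :
    linMap φ 0 (v ⊗ₜ ⟨1, S.one_mem⟩) = φ v := by
  change LinearMap.lTensor V _ (TensorProduct.assoc k V _ _ (φ v ⊗ₜ[k] _)) = φ v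
  generalize φ v = y
  induction y with
  | zero => simp
  | add a b ha hb => simp only [map_add, TensorProduct.add_tmul, ha, hb]
  | tmul w a => exact congrArg (w ⊗ₜ[k] ·) (Subtype.ext (mul_one a.1))
lemma Syz.exists_cover (hS : S.ConnectedOne) [Module.Finite k (S.piece 1)] {i : ℕ} (Z : Syz S i) :
    ∃ (Z' : Syz S (i + 1)) (ψ : (Fin Z'.n → k) →ₗ[k] (Fin Z.n → k) ⊗[k] S.piece 1),
      Z.Covers Z' ψ := by
  let e := freeEquiv S (Fin Z.n → k) (s := (i : ℕ)) (d := 1)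
    (show (i : ℤ) + 1 = (i : ℕ) + (1 : ℕ) by simp)
  have hfin : Module.Finite k ((free S (Fin Z.n → k) (i : ℕ)).X ((i : ℤ) + 1)) :=
    Module.Finite.equiv e
  have : Module.Finite k (Z.L.carrier ((i : ℤ) + 1)) := Module.Finite.of_injective
    (Z.L.carrier ((i : ℤ) + 1)).subtype Subtype.val_injective
  let b : (Fin (Module.finrank k (Z.L.carrier ((i : ℤ) + 1))) → k) ≃ₗ[k]
      Z.L.carrier ((i : ℤ) + 1) := LinearEquiv.ofFinrankEq _ _ (Module.finrank_fin_fun k)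
  let ψ := e.symm.toLinearMap ∘ₗ (Z.L.carrier ((i : ℤ) + 1)).subtype ∘ₗ b.toLinearMap
  have hψ : ∀ v, e (ψ v) = b v := fun v => e.apply_symm_apply _
  have hs : ((i + 1 : ℕ) : ℤ) = i + 1 := by push_cast; rfl
  let f := linHom ψ hs
  have hf : ∀ (l : ℤ) (d : ℕ) (hl : l = (i + 1 : ℕ) + (d : ℤ)) (hl' : l = i + (d + 1 : ℕ)) x,
    f.f l (freeEquiv S _ hl x) = freeEquiv S _ hl' (linMap ψ d x) :=
    fun l d hl hl' x => linHom_freeEquiv ψ hs hl hl' x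
  have hL : ∀ l x, f.f l x ∈ Z.L.carrier l := by
    intro l x
    change (_ → k) ⊗[k] _ at x
    induction x with
    | zero => rw [map_zero]; exact zero_mem _
    | add a b ha hb => rw [map_add]; exact add_mem ha hb
    | tmul v r =>
      have h1 : ∀ (l' : ℤ) (h : l' = i + 1) (h' : l' = i + (1 : ℕ)),
          freeEquiv S _ h' (ψ v) ∈ Z.L.carrier l' := by
        rintro _ rfl h'
        exact (hψ v).symm ▸ (b v).2
      exact Z.L.act_mem _ (h1 _ hs (by push_cast; rfl)) r
  have hinj : Injective (linMap ψ 0) := by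
    refine (injective_iff_map_eq_zero _).2 fun x hx => ?_
    obtain ⟨v, rfl⟩ := exists_eq_tmul_one hS x
    have h1 : ψ v = 0 := (linMap_zero_tmul_one ψ v).symm.trans hx
    have h2 := hψ v
    rw [h1, map_zero] at h2
    rw [(LinearEquiv.map_eq_zero_iff b).1 (Subtype.ext h2.symm), TensorProduct.zero_tmul]
  let p := Z.L.codRestrict f hL
  have hp : p.Surj := by
    refine (Z.reg 1).gen.hom_surj p fun l hl => ?_
    rintro ⟨x, hx⟩
    rcases hl.lt_or_eq with h | rfl
    · have h0 := hx
      rw [Z.low l (by omega)] at h0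
      exact ⟨0, Subtype.ext (by rw [map_zero]; exact ((Submodule.mem_bot k).1 h0).symm)⟩
    · refine ⟨freeEquiv S _ (d := 0) (by push_cast; omega) (b.symm ⟨x, hx⟩ ⊗ₜ ⟨1, S.one_mem⟩),
        Subtype.ext ?_⟩
      refine (hf _ 0 _ (by push_cast; omega) _).trans ?_
      refine (congrArg e (linMap_zero_tmul_one ψ _)).trans ?_
      rw [hψ, LinearEquiv.apply_symm_apply]
  have hrange : ∀ l, ∀ y ∈ Z.L.carrier l, ∃ z, f.f l z = y := by
    intro l y hy
    obtain ⟨z, hz⟩ := hp l ⟨y, hy⟩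
    exact ⟨z, congrArg Subtype.val hz⟩
  have hker : p.ker = f.ker := Sub.ker_codRestrict _ _ _
  have hcov : ∀ (d : ℕ) (l : ℤ) (hl : l = i + (d + 1 : ℕ)) x,
      freeEquiv S _ hl x ∈ Z.L.carrier l ↔ x ∈ LinearMap.range (linMap ψ d) := by
    intro d l hl x
    have h1 : l = (i + 1 : ℕ) + (d : ℤ) := by push_cast at hl ⊢; omega
    constructor
    · intro hx
      obtain ⟨y, hy⟩ := hrange l _ hx
      obtain ⟨z, rfl⟩ := (freeEquiv S _ h1).surjective y
      rw [hf l d h1 hl z] at hy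
      exact ⟨z, (freeEquiv S _ hl).injective hy⟩
    · rintro ⟨z, rfl⟩
      rw [← hf l d h1 hl z]
      exact hL _ _
  have hcov' : ∀ (d : ℕ) (l : ℤ) (hl : l = (i + 1 : ℕ) + (d + 1 : ℕ)) x,
      freeEquiv S _ hl x ∈ p.ker.carrier l ↔ linMap ψ (d + 1) x = 0 := by
    intro d l hl x
    rw [hker]
    change f.f l _ = 0 ↔ _
    rw [hf l (d + 1) hl (by push_cast at hl ⊢; omega) x, LinearEquiv.map_eq_zero_iff]
  refine ⟨⟨_, p.ker, ?_, ?_⟩, ψ, ?_, hinj, ?_⟩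
  · intro l hl
    rw [hker]
    refine eq_bot_iff.2 fun x hx => ?_
    rcases hl.lt_or_eq with h | rfl
    · have := subsingleton_free (S := S)
        (Fin (Module.finrank k (Z.L.carrier ((i : ℤ) + 1))) → k) h
      exact Subsingleton.elim _ _
    · have h1 : ((i + 1 : ℕ) : ℤ) = (i + 1 : ℕ) + ((0 : ℕ) : ℤ) := by simp
      obtain ⟨y, rfl⟩ := (freeEquiv S _ h1).surjective x
      have h2 := (hf _ 0 h1 (by push_cast; omega) y).symm.trans hx
      rw [LinearEquiv.map_eq_zero_iff] at h2
      rw [hinj (h2.trans (map_zero _).symm), map_zero]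
      exact zero_mem _
  · intro m
    have h1 := (Z.reg (m + 1)).ker p hp (proj_free _ _) ((gen_free _ _).mono hs.le)
    exact h1.mono (by rw [hs])
  · exact fun d => hcov d _ rfl
  · exact fun d => hcov' d _ rfl
lemma Syz.exists_resolution (hS : S.ConnectedOne) [Module.Finite k (S.piece 1)] (Z : Syz S 0)
    (P : ∀ m : ℕ, Sub (free S (Fin m → k) (0 : ℕ)) → Prop) (hP : P Z.n Z.L) :
    ∃ (u : ℕ → ℕ) (ψ : ∀ i : ℕ, (Fin (u (i + 1)) → k) →ₗ[k] ((Fin (u i) → k) ⊗[k] S.piece 1))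
      (L : Sub (free S (Fin (u 0) → k) (0 : ℕ))), P (u 0) L ∧
      (∀ d : ℕ, ∀ x, freeEquiv S _ (l := (0 : ℕ) + (d + 1 : ℕ)) rfl x ∈ L.carrier _ ↔
        x ∈ LinearMap.range (S.Dmap u ψ 0 d)) ∧
      (∀ i : ℕ, Injective (S.Dmap u ψ i 0)) ∧
      (∀ i d : ℕ,
        LinearMap.range (S.Dmap u ψ (i + 1) d) = LinearMap.ker (S.Dmap u ψ i (d + 1))) := by
  choose next χ hχ using fun (i : ℕ) (Z : Syz S i) => Z.exists_cover hS
  let st : ∀ i, Syz S i := fun i => Nat.rec Z (fun i Z => next i Z) i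
  refine ⟨fun i => (st i).n, fun i => χ i (st i), Z.L, hP, (hχ 0 Z).1,
    fun i => (hχ i (st i)).2.1, fun i d => ?_⟩
  ext x
  exact ((hχ (i + 1) (st (i + 1))).1 d x).symm.trans ((hχ i (st i)).2.2 d x)

lemma finite_piece_zero (hS : S.ConnectedOne) : Module.Finite k (S.piece 0) := by
  rw [show S.piece 0 = _ from hS]
  infer_instance

/-- The submodule of elements of positive degree in a free module. -/
def positivePart (S : GradedSystem k A) (V : Type) [AddCommGroup V] [Module k V] :
    Sub (free S V (0 : ℕ)) where
  carrier l := if l ≤ 0 then ⊥ else ⊤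
  act_mem {i j l} h x hx r := by
    by_cases hl : l ≤ 0
    · by_cases hj : j < 0
      · rw [(free S V (0 : ℕ)).act_of_neg h hj]
        exact zero_mem _
      · rw [if_pos (by omega), Submodule.mem_bot] at hx
        rw [hx]
        simp
    · rw [if_neg hl]
      trivial

lemma positivePart_succ (V : Type) [AddCommGroup V] [Module k V] {l : ℤ} {d : ℕ}
    (hl : l = (d + 1 : ℕ)) : (positivePart S V).carrier l = ⊤ :=
  if_neg (by push_cast at hl; omega)

/-- The positive part of a free module of rank one, as a first syzygy. -/
def positiveSyz (h : ∀ m, ConcReg S m) : Syz S 0 where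
  n := 1
  L := positivePart S _
  low l hl := if_pos hl
  reg m := by
    have h1 := (h (m + 1) _ 0 (conc_quot fun d => positivePart_succ (Fin 1 → k) rfl)).ker
      (positivePart S (Fin 1 → k)).mkQ (Sub.mkQ_surj _) (proj_free _ _) (gen_free _ _)
    rw [Sub.ker_mkQ] at h1
    exact h1

lemma isKoszul_of_concReg (hS : S.ConnectedOne) [Module.Finite k (S.piece 1)]
    (h : ∀ m, ConcReg S m) : S.IsKoszul := by
  obtain ⟨u, ψ, L, ⟨hu, hL⟩, h1, h2, h3⟩ := (positiveSyz h).exists_resolution hS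
    (fun m L => m = 1 ∧ ∀ d : ℕ, L.carrier ((0 : ℕ) + (d + 1 : ℕ)) = ⊤)
    ⟨rfl, fun d => positivePart_succ (d := d) _ (by simp)⟩
  refine ⟨hS, u, ψ, hu, fun d x => (h1 d x).1 ?_, h2, h3⟩
  rw [hL d]
  trivial

section Restrict

variable {B : Type} [Ring B] [Algebra k B] {R : GradedSystem k B}
  {π : ∀ n : ℕ, (R.piece n : Type) →ₗ[k] S.piece n}

lemma finite_piece_one (hR : R.ConnectedOne) (hS : S.IsKoszul) {n : ℕ → ℕ}
    {φ : ∀ i : ℕ, (Fin (n (i + 1)) → k) →ₗ[k] ((Fin (n i) → k) ⊗[k] R.piece 1)}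
    (hn0 : n 0 = 1)
    (hH0 : ∀ d : ℕ,
      Submodule.map (oneTensorEquiv hn0 (R.piece (d + 1) : Type)).toLinearMap
          (LinearMap.range (R.Dmap n φ 0 d)) = LinearMap.ker (π (d + 1))) :
    Module.Finite k (R.piece 1) := by
  obtain ⟨hS0, w, χ, hw, hsurj, -⟩ := hS
  have := finite_piece_zero hR
  have := finite_piece_zero hS0
  have h1 : Module.Finite k ((Fin (w 0) → k) ⊗[k] S.piece 1) :=
    Module.Finite.of_surjective (S.Dmap w χ 0 0) (hsurj 0)
  have h2 : Module.Finite k (S.piece 1) := Module.Finite.equiv (oneTensorEquiv hw (S.piece 1))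
  refine Module.finite_def.2 (Submodule.fg_of_fg_map_of_fg_inf_ker (π 1)
    (IsNoetherian.noetherian _) ?_)
  rw [top_inf_eq, show LinearMap.ker (π 1) = _ from (hH0 0).symm]
  have h3 : (LinearMap.range (R.Dmap n φ 0 0)).FG := by
    rw [LinearMap.range_eq_map]
    exact Module.Finite.fg_top.map _
  exact h3.map _

end Restrict

end RMod

end Modules

end GradedSystem

/-!  ### STATEMENT 0

Let `k` be a field, `R` a graded `k`-algebra with `R₀ = k`, and `A` a graded factor
algebra of `R` which is Koszul.  Suppose there exists a complex `K^·` of free graded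
right `R`-modules of the form `⋯ → V₂ ⊗ R(-2) → V₁ ⊗ R(-1) → R` (so
`K^i = V_i ⊗ R(-i)` with `V_i` finite-dimensional and `V₀ = k`) such that
`H₀(K^·) = A` and `H_p(K^·)_j = 0` for all `p ≥ 1` and all `j > p+1`.  Then `R` is
Koszul and `A` admits a linear free resolution as an `R`-module, i.e. a resolution
`⋯ → U₂ ⊗ R(-2) → U₁ ⊗ R(-1) → R → A → 0` with `U_i` finite-dimensional.

Complexes of free graded right modules are encoded by their components, as in
`GradedSystem.Dmap`; a graded factor algebra is a componentwise surjective map `π`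
respecting units and multiplication.  `H₀(K^·) = A` says that, in each degree
`d+1 ≥ 1`, the image of the last differential (transported along `V₀ ⊗ R ≃ R`) is
exactly `ker (π (d+1))`, and `H_p(K^·)_j = 0` says `ker ⊆ range` at the corresponding
component. -/
theorem koszul_from_almost_resolution {k A₁ A₂ : Type} [Field k]
    [Ring A₁] [Algebra k A₁] [Ring A₂] [Algebra k A₂]
    (R : GradedSystem k A₁) (A : GradedSystem k A₂)
    (hR0 : R.ConnectedOne)
    -- `A` is a graded factor algebra of `R`:
    (π : ∀ n : ℕ, (R.piece n : Type) →ₗ[k] A.piece n)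
    (hπ_surj : ∀ n : ℕ, Surjective (π n))
    (hπ_one : ((π 0 ⟨1, R.one_mem⟩ : A.piece 0) : A₂) = 1)
    (hπ_mul : ∀ (m n : ℕ) (x : R.piece m) (y : R.piece n),
      π (m + n) (R.mulMap m n x y) = A.mulMap m n (π m x) (π n y))
    -- `A` is Koszul:
    (hA : A.IsKoszul)
    -- the complex `K^·` of free right `R`-modules, `K^i = V_i ⊗ R(-i)`, `V_i = k^{n i}`:
    (n : ℕ → ℕ)
    (φ : ∀ i : ℕ, (Fin (n (i + 1)) → k) →ₗ[k] ((Fin (n i) → k) ⊗[k] R.piece 1))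
    (hn0 : n 0 = 1)
    (hcomplex : ∀ i d : ℕ, (R.Dmap n φ i (d + 1)) ∘ₗ (R.Dmap n φ (i + 1) d) = 0)
    -- `H₀(K^·) = A`:
    (hH0 : ∀ d : ℕ,
      Submodule.map (oneTensorEquiv hn0 (R.piece (d + 1) : Type)).toLinearMap
          (LinearMap.range (R.Dmap n φ 0 d)) = LinearMap.ker (π (d + 1)))
    -- `H_p(K^·)_j = 0` for `p ≥ 1`, `j > p + 1`:
    (hHp : ∀ i d : ℕ,
      LinearMap.ker (R.Dmap n φ i (d + 2)) ≤ LinearMap.range (R.Dmap n φ (i + 1) (d + 1))) :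
    -- conclusion: `R` is Koszul, and `A` has a linear free resolution over `R`:
    R.IsKoszul ∧
    ∃ (u : ℕ → ℕ) (hu : u 0 = 1)
      (ψ : ∀ i : ℕ, (Fin (u (i + 1)) → k) →ₗ[k] ((Fin (u i) → k) ⊗[k] R.piece 1)),
      -- exactness at `R` : the image of `U₁ ⊗ R(-1) → R` is `ker (R → A)`
      (∀ d : ℕ,
        Submodule.map (oneTensorEquiv hu (R.piece (d + 1) : Type)).toLinearMap
            (LinearMap.range (R.Dmap u ψ 0 d)) = LinearMap.ker (π (d + 1))) ∧
      -- exactness at the remaining spots: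
      (∀ i : ℕ, Injective (R.Dmap u ψ i 0)) ∧
      (∀ i d : ℕ,
        LinearMap.range (R.Dmap u ψ (i + 1) d) = LinearMap.ker (R.Dmap u ψ i (d + 1))) := by
  have hP := GradedSystem.RMod.concReg_of_almost_resolution hR0 hA hπ_surj hπ_one hπ_mul hn0
    hcomplex hH0 hHp
  have := GradedSystem.RMod.finite_piece_one hR0 hA hn0 hH0
  refine ⟨GradedSystem.RMod.isKoszul_of_concReg hR0 hP, ?_⟩
  let Z : GradedSystem.RMod.Syz R 0 :=
    { n := n 0
      L := (GradedSystem.RMod.cx n φ 0).range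
      low := fun l hl => GradedSystem.RMod.range_cx_zero n φ hl
      reg := fun m => ((hP m).reg_range_cx hcomplex hHp).pred }
  obtain ⟨u, ψ, L, ⟨hu, hL⟩, h1, h2, h3⟩ := Z.exists_resolution hR0
    (fun m L => ∃ h : m = 1, ∀ d : ℕ,
      Submodule.map (oneTensorEquiv h (R.piece (d + 1) : Type)).toLinearMap
        ((L.carrier ((0 : ℕ) + (d + 1 : ℕ))).comap
          (GradedSystem.RMod.freeEquiv R (Fin m → k) rfl).toLinearMap) = LinearMap.ker (π (d + 1)))
    ⟨hn0, fun d => by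
      rw [← hH0 d]
      congr 1
      ext x
      exact GradedSystem.RMod.mem_range_cx (n := n) (φ := φ) (i := 0) (d := d) rfl x⟩
  refine ⟨u, hu, ψ, fun d => ?_, h2, h3⟩
  rw [← hL d]
  congr 1
  ext x
  exact (h1 d x).symm

end
end

section
/- Let C be a smooth connected projective complex curve of genus g ≥ 3 with canonical bundle K, and let D be a divisor of degree g-1 on C such that |D| is a base-point-free pencil. Then for every n ≥ 0 the natural multiplication map H^0(C, O(D)) ⊗ H^0(C, K^n) → H^0(C, K^n(D)) is surjective. -/
open TensorProduct Function

noncomputable section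


/-!  ### Smooth connected projective complex curves

A smooth connected projective curve over `ℂ` is (equivalently) presented through its
function field `F` — a finitely generated extension of `ℂ` of transcendence degree 1 —
together with its set of points (= places of `F/ℂ`), each point giving an
order-of-vanishing valuation `ord P : F → ℤ`.  Divisors are finitely supported `ℤ`-valued
functions on points, and `H⁰(C, O(D))` is the Riemann–Roch space of `D`. -/
structure PreCurve where
  /-- the function field of the curve -/
  F : Type
  [fieldF : Field F]
  [algF : Algebra ℂ F]
  /-- `F` is a finitely generated extension of `ℂ` of transcendence degree 1 -/
  trdeg_one : ∃ x : F, Transcendental ℂ x ∧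
    FiniteDimensional (IntermediateField.adjoin ℂ {x}) F
  /-- the (closed) points of the curve -/
  Point : Type
  /-- order of vanishing of a rational function at a point -/
  ord : Point → F → ℤ
  ord_zero' : ∀ P, ord P 0 = 0
  ord_mul : ∀ P, ∀ f g : F, f ≠ 0 → g ≠ 0 → ord P (f * g) = ord P f + ord P g
  ord_add : ∀ P, ∀ f g : F, f ≠ 0 → g ≠ 0 → f + g ≠ 0 →
    min (ord P f) (ord P g) ≤ ord P (f + g)
  ord_algebraMap : ∀ P, ∀ c : ℂ, c ≠ 0 → ord P (algebraMap ℂ F c) = 0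
  /-- every point admits a local uniformizer (the valuation is surjective) -/
  ord_uniformizer : ∀ P, ∃ f : F, f ≠ 0 ∧ ord P f = 1
  /-- a nonzero rational function has only finitely many zeros and poles -/
  ord_finite_support : ∀ f : F, f ≠ 0 → (Function.support fun P => ord P f).Finite
  /-- distinct points are separated by rational functions -/
  ord_separates : ∀ P Q : Point, P ≠ Q → ∃ f : F, f ≠ 0 ∧ 0 < ord P f ∧ ord Q f = 0

attribute [instance] PreCurve.fieldF PreCurve.algF

namespace PreCurve

variable (C : PreCurve)

/-- Divisors on the curve. -/
abbrev Div := C.Point →₀ ℤ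

/-- The divisor of a single point. -/
def pt (P : C.Point) : C.Div := Finsupp.single P 1

/-- The degree of a divisor. -/
def deg (D : C.Div) : ℤ := D.sum fun _ n => n

/-- The Riemann–Roch space `H⁰(C, O(D)) = {f ∈ F | div f + D ≥ 0} ∪ {0}`. -/
def H0 (D : C.Div) : Submodule ℂ C.F where
  carrier := {f : C.F | f = 0 ∨ ∀ P, 0 ≤ C.ord P f + D P}
  zero_mem' := Or.inl rfl
  add_mem' := by
    intro f g hf hg
    rcases eq_or_ne f 0 with rfl | hf0
    · simpa using hg
    rcases eq_or_ne g 0 with rfl | hg0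
    · simpa using hf
    rcases eq_or_ne (f + g) 0 with h0 | h0
    · exact Or.inl h0
    rcases hf with rfl | hf
    · exact absurd rfl hf0
    rcases hg with rfl | hg
    · exact absurd rfl hg0
    refine Or.inr fun P => ?_
    have hmin := C.ord_add P f g hf0 hg0 h0
    rcases le_total (C.ord P f) (C.ord P g) with hle | hle
    · rw [min_eq_left hle] at hmin
      have := hf P; omega
    · rw [min_eq_right hle] at hmin
      have := hg P; omega
  smul_mem' := by
    intro c f hf
    rcases eq_or_ne c 0 with rfl | hc
    · exact Or.inl (zero_smul ℂ f)
    rcases hf with rfl | hf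
    · exact Or.inl (smul_zero c)
    rcases eq_or_ne f 0 with rfl | hf0
    · exact Or.inl (smul_zero c)
    refine Or.inr fun P => ?_
    have hmap : (algebraMap ℂ C.F c) ≠ 0 := fun h =>
      hc ((algebraMap ℂ C.F).injective (by rw [h, map_zero]))
    have hsm : c • f = algebraMap ℂ C.F c * f := Algebra.smul_def c f
    rw [hsm, C.ord_mul P _ f hmap hf0, C.ord_algebraMap P c hc]
    simpa using hf P

theorem mem_H0 {D : C.Div} {f : C.F} :
    f ∈ C.H0 D ↔ (f = 0 ∨ ∀ P, 0 ≤ C.ord P f + D P) := Iff.rfl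

/-- `h⁰(D) = dim H⁰(C, O(D))`. -/
def h0 (D : C.Div) : ℕ := Module.finrank ℂ (C.H0 D)

theorem H0_mono {D E : C.Div} (h : ∀ P, D P ≤ E P) : C.H0 D ≤ C.H0 E := by
  intro f hf
  rcases (C.mem_H0.mp hf) with rfl | hf
  · exact (C.H0 E).zero_mem
  · exact C.mem_H0.mpr (Or.inr fun P => by have := h P; have := hf P; omega)

theorem mul_mem_H0 {D E : C.Div} {f g : C.F} (hf : f ∈ C.H0 D) (hg : g ∈ C.H0 E) :
    f * g ∈ C.H0 (D + E) := by
  rcases (C.mem_H0.mp hf) with rfl | hf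
  · exact C.mem_H0.mpr (Or.inl (zero_mul g))
  rcases (C.mem_H0.mp hg) with rfl | hg
  · exact C.mem_H0.mpr (Or.inl (mul_zero f))
  rcases eq_or_ne f 0 with rfl | hf0
  · exact C.mem_H0.mpr (Or.inl (zero_mul g))
  rcases eq_or_ne g 0 with rfl | hg0
  · exact C.mem_H0.mpr (Or.inl (mul_zero f))
  refine C.mem_H0.mpr (Or.inr fun P => ?_)
  rw [C.ord_mul P f g hf0 hg0, Finsupp.add_apply]
  have := hf P; have := hg P; omega

/-- Multiplication of sections, `H⁰(D) ⊗ H⁰(E) → H⁰(D + E)`, as a bilinear map. -/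
def mulH0 (D E : C.Div) : C.H0 D →ₗ[ℂ] C.H0 E →ₗ[ℂ] C.H0 (D + E) :=
  LinearMap.mk₂ ℂ (fun f g => ⟨(f : C.F) * (g : C.F), C.mul_mem_H0 f.2 g.2⟩)
    (fun f f' g => Subtype.ext (by simp [add_mul]))
    (fun c f g => Subtype.ext (by simp [smul_mul_assoc]))
    (fun f g g' => Subtype.ext (by simp [mul_add]))
    (fun c f g => Subtype.ext (by simp [mul_smul_comm]))

/-- Transport of `H⁰` along an equality of divisors. -/
def castH0 {D E : C.Div} (h : D = E) : (C.H0 D : Type) ≃ₗ[ℂ] C.H0 E :=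
  LinearEquiv.ofEq _ _ (by rw [h])

/-- The multiplication map `H⁰(D) ⊗ H⁰(E) → H⁰(G)` for `G = D + E`. -/
def mulTo (D E G : C.Div) (h : D + E = G) : (C.H0 D ⊗[ℂ] C.H0 E) →ₗ[ℂ] C.H0 G :=
  (C.castH0 h).toLinearMap ∘ₗ TensorProduct.lift (C.mulH0 D E)

/-- The inclusion `H⁰(D) ⊆ H⁰(E)` for `D ≤ E`. -/
def inclH0 {D E : C.Div} (h : ∀ P, D P ≤ E P) : (C.H0 D : Type) →ₗ[ℂ] C.H0 E :=
  Submodule.inclusion (C.H0_mono h)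

/-- Multiplication by a fixed section `a ∈ H⁰(E)`, as a map `H⁰(M) → H⁰(E + M)`. -/
def mulBy {E : C.Div} (a : C.F) (ha : a ∈ C.H0 E) (M : C.Div) :
    (C.H0 M : Type) →ₗ[ℂ] C.H0 (E + M) :=
  C.mulH0 E M ⟨a, ha⟩

/-- The reduced effective divisor attached to a finite set of points. -/
def divOfFinset (s : Finset C.Point) : C.Div := ∑ P ∈ s, C.pt P

/-- The divisor of a nonzero rational function. -/
def divOf (f : C.F) : C.Div := by
  classical
  exact if h : f = 0 then 0
    else Finsupp.ofSupportFinite (fun P => C.ord P f) (C.ord_finite_support f h)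

/-- Linear equivalence of divisors. -/
def LinEquiv (D E : C.Div) : Prop := ∃ f : C.F, f ≠ 0 ∧ D - E = C.divOf f

end PreCurve

/-- A smooth connected projective complex curve: the data of `PreCurve` together with
properness (principal divisors have degree zero), finite–dimensionality of Riemann–Roch
spaces, `H⁰(O) = ℂ`, a canonical divisor `K`, and the genus, tied together by the
Riemann–Roch theorem (in its Serre-duality form `h⁰(D) − h⁰(K−D) = deg D + 1 − g`). -/
structure Curve extends PreCurve where
  deg_principal : ∀ f : toPreCurve.F, f ≠ 0 → (∑ᶠ P, toPreCurve.ord P f) = 0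
  finiteDim : ∀ D : toPreCurve.Div, FiniteDimensional ℂ (toPreCurve.H0 D)
  h0_triv : toPreCurve.h0 0 = 1
  /-- a canonical divisor (class) of the curve -/
  K : toPreCurve.Div
  /-- the genus of the curve -/
  genus : ℕ
  riemann_roch : ∀ D : toPreCurve.Div,
    (toPreCurve.h0 D : ℤ) - toPreCurve.h0 (K - D) = toPreCurve.deg D + 1 - genus

namespace Curve

variable (C : Curve)

/-- `h¹(D)`, via Serre duality. -/
def h1 (D : C.Div) : ℕ := C.h0 (C.K - D)

/-- The complete linear system `|D|` is base-point free. -/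
def BasePointFree (D : C.Div) : Prop := ∀ P : C.Point, C.h0 (D - C.pt P) + 1 = C.h0 D

/-- `|D|` is a base-point-free pencil (base-point free of projective dimension 1). -/
def IsBPFPencil (D : C.Div) : Prop := C.BasePointFree D ∧ C.h0 D = 2

/-- `C` is hyperelliptic: it carries a `g¹₂`. -/
def Hyperelliptic : Prop := ∃ D : C.Div, C.deg D = 2 ∧ 2 ≤ C.h0 D

/-- `C` is trigonal: it admits a degree-3 map to `ℙ¹`. -/
def Trigonal : Prop := ∃ D : C.Div, C.deg D = 3 ∧ 2 ≤ C.h0 D ∧ C.BasePointFree D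

/-- `D` is very ample (it separates points and tangent vectors). -/
def VeryAmple (D : C.Div) : Prop :=
  ∀ P Q : C.Point, C.h0 (D - C.pt P - C.pt Q) + 2 = C.h0 D

/-- `C` is a smooth plane quintic: it carries a very ample `g²₅`. -/
def IsPlaneQuintic : Prop := ∃ D : C.Div, C.deg D = 5 ∧ C.h0 D = 3 ∧ C.VeryAmple D

/-- The homogeneous coordinate algebra `R_L = ⊕ₙ H⁰(C, Lⁿ)` of a divisor (class) `L`,
as a graded system inside the function field. -/
def RL (L : C.Div) : GradedSystem ℂ C.F where
  piece n := C.H0 (n • L)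
  one_mem := by
    refine C.mem_H0.mpr (Or.inr fun P => ?_)
    have h1 : C.ord P 1 = 0 := by
      simpa using C.ord_algebraMap P 1 one_ne_zero
    simp [h1]
  mul_mem := by
    intro m n x y hx hy
    have h := C.mul_mem_H0 hx hy
    show x * y ∈ C.H0 ((m + n) • L)
    rwa [add_smul]

/-- The embedding given by the complete linear system `|L|` is projectively normal:
`R_L` is generated in degree one (equivalently, `Symⁿ H⁰(L) → H⁰(Lⁿ)` is surjective
for all `n`). -/
def ProjectivelyNormal (L : C.Div) : Prop :=
  ∀ n : ℕ, Surjective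
    (C.mulTo L (n • L) ((n + 1) • L) ((add_comm L (n • L)).trans (succ_nsmul L n).symm))

end Curve

/-- The homology of a (two-step) complex `X → Y → Z` at `Y`. -/
def homol {X Y Z : Type} [AddCommGroup X] [AddCommGroup Y] [AddCommGroup Z]
    [Module ℂ X] [Module ℂ Y] [Module ℂ Z] (f : X →ₗ[ℂ] Y) (g : Y →ₗ[ℂ] Z) : Type :=
  ↥(LinearMap.ker g) ⧸ Submodule.comap (LinearMap.ker g).subtype (LinearMap.range f)


namespace PreCurve

variable (C : PreCurve)

theorem deg_add (D E : C.Div) : C.deg (D + E) = C.deg D + C.deg E :=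
  Finsupp.sum_add_index' (fun _ => rfl) (fun _ _ _ => rfl)

theorem deg_sub (D E : C.Div) : C.deg (D - E) = C.deg D - C.deg E :=
  Finsupp.sum_sub_index (fun _ _ _ => rfl)

theorem deg_zero : C.deg 0 = 0 := Finsupp.sum_zero_index

theorem deg_nsmul (n : ℕ) (D : C.Div) : C.deg (n • D) = n * C.deg D := by
  induction n with
  | zero => simp [deg_zero]
  | succ n ih => rw [succ_nsmul, deg_add, ih]; push_cast; ring

theorem ord_div (P : C.Point) {f g : C.F} (hf : f ≠ 0) (hg : g ≠ 0) :
    C.ord P (f / g) = C.ord P f - C.ord P g := by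
  have h := C.ord_mul P (f / g) g (div_ne_zero hf hg) hg
  rw [div_mul_cancel₀ f hg] at h
  omega

/-- A section of `O(D)` that is not a section of `O(D - P)` generates `O(D)` at `P`. -/
theorem ord_eq_of_notMem_sub_pt {D : C.Div} {P : C.Point} {f : C.F} (hf : f ∈ C.H0 D)
    (hP : f ∉ C.H0 (D - C.pt P)) : C.ord P f = -D P := by
  classical
  have hf0 : f ≠ 0 := by rintro rfl; exact hP (Submodule.zero_mem _)
  have hf' := (C.mem_H0.mp hf).resolve_left hf0
  by_contra hne
  refine hP (C.mem_H0.mpr (Or.inr fun Q => ?_))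
  have hQ := hf' Q
  by_cases h : P = Q
  · subst h
    simp only [pt, Finsupp.sub_apply, Finsupp.single_eq_same]
    omega
  · simp only [pt, Finsupp.sub_apply, Finsupp.single_apply, if_neg h]
    omega

/-- Two sections of `O(D)` without common zeros, in the sense that at each point one of them
has the minimal order allowed by `D`. -/
def NoCommonZero (D : C.Div) (s t : C.F) : Prop :=
  ∀ P, C.ord P s = -D P ∨ C.ord P t = -D P

variable {C}

theorem div_mem_H0_sub {D M : C.Div} {s t a b : C.F} (hs : s ≠ 0) (ht : t ≠ 0)
    (hst : C.NoCommonZero D s t) (ha : a ∈ C.H0 M) (hb : b ∈ C.H0 M)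
    (h : s * a + t * b = 0) : a / t ∈ C.H0 (M - D) := by
  rcases eq_or_ne a 0 with rfl | ha0
  · rw [zero_div]; exact Submodule.zero_mem _
  have hb0 : b ≠ 0 := by
    rintro rfl
    simp [hs, ha0] at h
  have hab : a / t = -b / s := by
    rw [div_eq_div_iff ht hs]
    linear_combination h
  refine C.mem_H0.mpr (Or.inr fun P => ?_)
  rw [Finsupp.sub_apply]
  rcases hst P with hP | hP
  · have hnb := (C.mem_H0.mp ((C.H0 M).neg_mem hb)).resolve_left (neg_ne_zero.mpr hb0) P
    rw [hab, C.ord_div P (neg_ne_zero.mpr hb0) hs]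
    omega
  · have haP := (C.mem_H0.mp ha).resolve_left ha0 P
    rw [C.ord_div P ha0 ht]
    omega

variable (C)

/-- The map `H⁰(M)² → H⁰(D + M)`, `(a, b) ↦ s a + t b`, for sections `s, t` of `O(D)`. -/
def pencilMap {D : C.Div} (s t : C.H0 D) (M : C.Div) :
    (C.H0 M × C.H0 M) →ₗ[ℂ] C.H0 (D + M) :=
  (C.mulH0 D M s).coprod (C.mulH0 D M t)

theorem coe_pencilMap {D : C.Div} (s t : C.H0 D) (M : C.Div) (x : C.H0 M × C.H0 M) :
    (C.pencilMap s t M x : C.F) = s * x.1 + t * x.2 := rfl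

/-- The kernel of `pencilMap` embeds in `H⁰(M - D)` (base-point-free pencil trick). -/
theorem finrank_ker_pencilMap_le {D : C.Div} {s t : C.H0 D} (M : C.Div)
    [FiniteDimensional ℂ (C.H0 (M - D))] (hs : (s : C.F) ≠ 0) (ht : (t : C.F) ≠ 0)
    (hst : C.NoCommonZero D s t) :
    Module.finrank ℂ (LinearMap.ker (C.pencilMap s t M)) ≤ C.h0 (M - D) := by
  have hker : ∀ x : LinearMap.ker (C.pencilMap s t M),
      (s : C.F) * x.1.1 + t * x.1.2 = 0 := fun x => by
    rw [← coe_pencilMap, LinearMap.mem_ker.mp x.2, Submodule.coe_zero]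
  let φ : LinearMap.ker (C.pencilMap s t M) →ₗ[ℂ] C.H0 (M - D) :=
    { toFun := fun x => ⟨(x.1.1 : C.F) / t,
        div_mem_H0_sub hs ht hst x.1.1.2 x.1.2.2 (hker x)⟩
      map_add' := fun x y => Subtype.ext (by simp [add_div])
      map_smul' := fun c x => Subtype.ext (by simp [smul_div_assoc]) }
  refine LinearMap.finrank_le_finrank_of_injective (f := φ) ?_
  rw [injective_iff_map_eq_zero]
  intro x hx
  have h1 : (x.1.1 : C.F) = 0 := by
    have h : (x.1.1 : C.F) / t = 0 := congrArg Subtype.val hx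
    simpa [ht] using h
  have h2 : (x.1.2 : C.F) = 0 := by simpa [h1, ht] using hker x
  exact Subtype.ext (Prod.ext (Subtype.ext h1) (Subtype.ext h2))

theorem range_pencilMap_le {D : C.Div} (s t : C.H0 D) (M : C.Div) :
    LinearMap.range (C.pencilMap s t M) ≤
      LinearMap.range (TensorProduct.lift (C.mulH0 D M)) := by
  rintro _ ⟨x, rfl⟩
  exact ⟨s ⊗ₜ x.1 + t ⊗ₜ x.2, by simp [pencilMap]⟩

end PreCurve

namespace Curve

variable (C : Curve)

theorem h0_eq_zero_of_deg_neg {D : C.Div} (hD : C.deg D < 0) : C.h0 D = 0 := by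
  have hbot : C.H0 D = ⊥ := by
    refine (Submodule.eq_bot_iff _).mpr fun f hf => ?_
    by_contra hf0
    have hf' := (C.mem_H0.mp hf).resolve_left hf0
    let E : C.Div := Finsupp.ofSupportFinite (fun P => C.ord P f) (C.ord_finite_support f hf0)
    have hE : C.deg E = 0 := by
      rw [← C.deg_principal f hf0]
      exact (finsum_eq_sum_of_support_subset _ (by simp [E])).symm
    have hsum : 0 ≤ C.deg (E + D) := Finset.sum_nonneg fun P _ => hf' P
    rw [C.deg_add, hE] at hsum
    omega
  rw [PreCurve.h0, hbot, finrank_bot]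

theorem h0_K : C.h0 C.K = C.genus := by
  have h := C.riemann_roch 0
  rw [C.h0_triv, sub_zero, C.deg_zero] at h
  omega

theorem deg_K : C.deg C.K = 2 * C.genus - 2 := by
  have h := C.riemann_roch C.K
  rw [sub_self, C.h0_triv, C.h0_K] at h
  omega

theorem h0_eq_of_deg_K_lt {D : C.Div} (hD : 2 * (C.genus : ℤ) - 2 < C.deg D) :
    (C.h0 D : ℤ) = C.deg D + 1 - C.genus := by
  have h := C.riemann_roch D
  rw [C.h0_eq_zero_of_deg_neg (D := C.K - D) (by rw [C.deg_sub, C.deg_K]; omega)] at h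
  simpa using h

theorem IsBPFPencil.exists_noCommonZero {C : Curve} {D : C.Div} (hD : C.IsBPFPencil D) :
    ∃ s t : C.H0 D, (s : C.F) ≠ 0 ∧ (t : C.F) ≠ 0 ∧ C.NoCommonZero D s t := by
  have : FiniteDimensional ℂ (C.H0 D) := C.finiteDim D
  let b := Module.finBasisOfFinrankEq ℂ (C.H0 D) hD.2
  refine ⟨b 0, b 1, by simpa using b.ne_zero 0, by simpa using b.ne_zero 1, fun P => ?_⟩
  by_contra! hP
  have hmem : ∀ i, (b i : C.F) ∈ C.H0 (D - C.pt P) := fun i => by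
    by_contra hi
    have := C.ord_eq_of_notMem_sub_pt (b i).2 hi
    fin_cases i
    · exact hP.1 this
    · exact hP.2 this
  have hle : C.H0 D ≤ C.H0 (D - C.pt P) := fun f hf => by
    have hsum := congrArg Subtype.val (b.sum_repr ⟨f, hf⟩)
    rw [Fin.sum_univ_two] at hsum
    have hsum' : b.repr ⟨f, hf⟩ 0 • (b 0 : C.F) + b.repr ⟨f, hf⟩ 1 • (b 1 : C.F) = f := hsum
    rw [← hsum']
    exact Submodule.add_mem _ (Submodule.smul_mem _ _ (hmem 0)) (Submodule.smul_mem _ _ (hmem 1))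
  have : FiniteDimensional ℂ (C.H0 (D - C.pt P)) := C.finiteDim _
  have h1 : C.h0 D ≤ C.h0 (D - C.pt P) := Submodule.finrank_mono hle
  have h2 := hD.1 P
  omega

/-- Multiplication by a base-point-free pencil `|D|` is surjective on `H⁰(M)` as soon as the
dimension count given by the base-point-free pencil trick allows it. -/
theorem IsBPFPencil.surjective_mulTo {C : Curve} {D M G : C.Div} (hD : C.IsBPFPencil D)
    (hG : D + M = G) (hM : C.h0 (D + M) + C.h0 (M - D) ≤ 2 * C.h0 M) :
    Surjective (C.mulTo D M G hG) := by
  obtain ⟨s, t, hs, ht, hst⟩ := hD.exists_noCommonZero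
  have : FiniteDimensional ℂ (C.H0 M) := C.finiteDim M
  have : FiniteDimensional ℂ (C.H0 (M - D)) := C.finiteDim (M - D)
  have : FiniteDimensional ℂ (C.H0 (D + M)) := C.finiteDim (D + M)
  have hker := C.finrank_ker_pencilMap_le M hs ht hst
  have hrank := LinearMap.finrank_range_add_finrank_ker (C.pencilMap s t M)
  rw [Module.finrank_prod] at hrank
  have htop : LinearMap.range (C.pencilMap s t M) = ⊤ := by
    refine Submodule.eq_top_of_finrank_eq (le_antisymm (Submodule.finrank_le _) ?_)
    simp only [PreCurve.h0] at hM hker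
    omega
  have hsurj : Surjective (TensorProduct.lift (C.mulH0 D M)) :=
    LinearMap.range_eq_top.mp (top_le_iff.mp (htop ▸ C.range_pencilMap_le s t M))
  exact (C.castH0 hG).surjective.comp hsurj

end Curve

/-!  ### STATEMENT 2

Let `C` be a smooth connected projective complex curve of genus `g ≥ 3` with canonical
bundle `K`, and let `D` be a divisor of degree `g-1` on `C` such that `|D|` is a
base-point-free pencil.  Then for every `n ≥ 0` the natural multiplication map
`H⁰(C, O(D)) ⊗ H⁰(C, Kⁿ) → H⁰(C, Kⁿ(D))` is surjective. -/
theorem mult_by_pencil_surjective (C : Curve) (hg : 3 ≤ C.genus) (D : C.Div)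
    (hdeg : C.deg D = (C.genus : ℤ) - 1) (hD : C.IsBPFPencil D) :
    ∀ n : ℕ, Surjective (C.mulTo D (n • C.K) (n • C.K + D) (add_comm D (n • C.K))) := by
  intro n
  refine hD.surjective_mulTo _ ?_
  have hdegn : C.deg (n • C.K) = n * (2 * C.genus - 2) := by rw [C.deg_nsmul, C.deg_K]
  have hsub : C.deg (n • C.K - D) = n * (2 * C.genus - 2) - (C.genus - 1) := by
    rw [C.deg_sub, hdegn, hdeg]
  have hadd : C.deg (D + n • C.K) = (C.genus - 1) + n * (2 * C.genus - 2) := by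
    rw [C.deg_add, hdegn, hdeg]
  have hg' : (3 : ℤ) ≤ C.genus := by exact_mod_cast hg
  obtain rfl | rfl | hn : n = 0 ∨ n = 1 ∨ 2 ≤ n := by omega
  · have h := C.h0_eq_zero_of_deg_neg (D := 0 • C.K - D) (by rw [hsub]; push_cast; linarith)
    rw [h, zero_smul, add_zero, add_zero, hD.2, C.h0_triv]
  · have h1 := C.h0_eq_of_deg_K_lt (D := D + 1 • C.K) (by rw [hadd]; push_cast; linarith)
    have h2 := C.riemann_roch D
    rw [hD.2, hdeg] at h2
    rw [hadd] at h1
    rw [one_smul] at h1 ⊢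
    rw [C.h0_K]
    push_cast at h1
    omega
  · have hn' : (2 : ℤ) ≤ n := by exact_mod_cast hn
    have hmul : 2 * (2 * (C.genus : ℤ) - 2) ≤ n * (2 * C.genus - 2) :=
      mul_le_mul_of_nonneg_right hn' (by linarith)
    have h1 := C.h0_eq_of_deg_K_lt (D := D + n • C.K) (by linarith)
    have h2 := C.h0_eq_of_deg_K_lt (D := n • C.K - D) (by linarith)
    have h3 := C.h0_eq_of_deg_K_lt (D := n • C.K) (by linarith)
    zify
    linarith

end
end

section
/- Let Z be a set of d distinct points in general linear position in the projective space P^{d-p} over a field, with p ≤ d/2. Then the homogeneous coordinate algebra of Z (the quotient of the polynomial ring in d-p+1 variables by the homogeneous ideal of Z) is Koszul. -/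
open TensorProduct Function

noncomputable section


/-!  ### STATEMENT 4  (Kempf)

Let `Z` be a set of `d` distinct points in general linear position in `ℙ^{d-p}` over a
field `k`, with `p ≤ d/2`.  Then the homogeneous coordinate algebra of `Z` — the
quotient of the polynomial ring in `d-p+1` variables by the homogeneous ideal of `Z` —
is Koszul.

The points are given by nonzero coordinate vectors `x j ∈ k^{d-p+1}`, pairwise
non-proportional (distinctness in `ℙ^{d-p}`); general linear position means that any
`≤ d-p+1` of them are linearly independent. -/

/-- The homogeneous ideal of the point set: the ideal generated by the homogeneous
polynomials vanishing at all the points. -/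
def pointsIdeal (k : Type) [Field k] {N d : ℕ} (x : Fin d → (Fin N → k)) :
    Ideal (MvPolynomial (Fin N) k) :=
  Ideal.span {q | (∃ n, MvPolynomial.IsHomogeneous q n) ∧
    ∀ j, MvPolynomial.eval (x j) q = 0}

/-- The homogeneous coordinate algebra of the point set, with its grading by the
images of the spaces of homogeneous polynomials. -/
def pointsSystem (k : Type) [Field k] {N d : ℕ} (x : Fin d → (Fin N → k)) :
    GradedSystem k (MvPolynomial (Fin N) k ⧸ pointsIdeal k x) where
  piece n := Submodule.map (Ideal.Quotient.mkₐ k (pointsIdeal k x)).toLinearMap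
    (MvPolynomial.homogeneousSubmodule (Fin N) k n)
  one_mem := by
    refine Submodule.mem_map.mpr ⟨1, ?_, by simp⟩
    exact (MvPolynomial.mem_homogeneousSubmodule _ _).mpr
      (MvPolynomial.isHomogeneous_one _ _)
  mul_mem := by
    rintro m n a b ha hb
    rcases Submodule.mem_map.mp ha with ⟨p, hp, rfl⟩
    rcases Submodule.mem_map.mp hb with ⟨q, hq, rfl⟩
    refine Submodule.mem_map.mpr ⟨p * q, ?_, by simp⟩
    exact (MvPolynomial.mem_homogeneousSubmodule _ _).mpr
      (((MvPolynomial.mem_homogeneousSubmodule _ _).mp hp).mul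
        ((MvPolynomial.mem_homogeneousSubmodule _ _).mp hq))

/-! ### Linear resolutions of graded modules

A graded module over `S` is presented by a family `P : ℕ → AddSubgroup E` of subgroups of an
ambient `A`-module `E`. -/

namespace GradedSystem

section Linear

variable {k A : Type} [Field k] [CommRing A] [Algebra k A] (S : GradedSystem k A)

/-- The vectors `e` form a basis of `P 0` over `S.piece 0`, and generate `P`. -/
def IsMinimalGenerators {E : Type} [AddCommGroup E] [Module A E] (P : ℕ → AddSubgroup E)
    {m : ℕ} (e : Fin m → E) : Prop :=
  (∀ a : Fin m → A, (∀ i, a i ∈ S.piece 0) → ∑ i, a i • e i = 0 → a = 0) ∧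
  ∀ j y, y ∈ P j ↔ ∃ a : Fin m → A, (∀ i, a i ∈ S.piece j) ∧ ∑ i, a i • e i = y

/-- The first syzygies of a system of generators of degree `0`, with the grading shifted
by one. -/
def syzygies {E : Type} [AddCommGroup E] [Module A E] {m : ℕ} (e : Fin m → E) (j : ℕ) :
    AddSubgroup (Fin m → A) where
  carrier := {a | (∀ i, a i ∈ S.piece (j + 1)) ∧ ∑ i, a i • e i = 0}
  zero_mem' := ⟨fun _ => Submodule.zero_mem _, by simp⟩
  add_mem' := by
    rintro a b ⟨ha, ha'⟩ ⟨hb, hb'⟩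
    exact ⟨fun i => Submodule.add_mem _ (ha i) (hb i), by
      simp [add_smul, Finset.sum_add_distrib, ha', hb']⟩
  neg_mem' := by
    rintro a ⟨ha, ha'⟩
    exact ⟨fun i => Submodule.neg_mem _ (ha i), by simp [ha']⟩

variable {S} in
lemma mem_syzygies {E : Type} [AddCommGroup E] [Module A E] {m : ℕ} {e : Fin m → E} {j : ℕ}
    {a : Fin m → A} :
    a ∈ S.syzygies e j ↔ (∀ i, a i ∈ S.piece (j + 1)) ∧ ∑ i, a i • e i = 0 := Iff.rfl

lemma smul_mem_syzygies {E : Type} [AddCommGroup E] [Module A E] {m : ℕ} (e : Fin m → E)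
    {j : ℕ} {a : A} (ha : a ∈ S.piece j) {y : Fin m → A} (hy : y ∈ S.syzygies e 0) :
    a • y ∈ S.syzygies e j :=
  ⟨fun i => S.mul_mem ha (hy.1 i), by
    simp only [Pi.smul_apply, smul_assoc, ← Finset.smul_sum, hy.2, smul_zero]⟩

/-- The smallest class of graded modules that contains zero and the cyclic modules whose
annihilator (shifted by one) belongs to `𝒰`, and is closed under extensions. -/
inductive Filtered (𝒰 : Set (ℕ → AddSubgroup A)) :
    ∀ {E : Type} [AddCommGroup E] [Module A E], (ℕ → AddSubgroup E) → Prop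
  | zero {E : Type} [AddCommGroup E] [Module A E] (P : ℕ → AddSubgroup E)
      (h : ∀ j, ∀ y ∈ P j, y = 0) : Filtered 𝒰 P
  | cyclic {E : Type} [AddCommGroup E] [Module A E] (P : ℕ → AddSubgroup E) (e : E)
      (he : ∀ a ∈ S.piece 0, a • e = 0 → a = 0)
      (hP : ∀ j y, y ∈ P j ↔ ∃ a ∈ S.piece j, a • e = y)
      (Q : ℕ → AddSubgroup A) (hQ : Q ∈ 𝒰)
      (hann : ∀ j a, a ∈ Q j ↔ a ∈ S.piece (j + 1) ∧ a • e = 0) : Filtered 𝒰 P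
  | extension {E' E E'' : Type} [AddCommGroup E'] [Module A E'] [AddCommGroup E] [Module A E]
      [AddCommGroup E''] [Module A E''] (P' : ℕ → AddSubgroup E') (P : ℕ → AddSubgroup E)
      (P'' : ℕ → AddSubgroup E'') (f : E' →ₗ[A] E) (g : E →ₗ[A] E'')
      (hsmul : ∀ j, ∀ a ∈ S.piece j, ∀ y ∈ P 0, a • y ∈ P j)
      (hf : ∀ j, ∀ y ∈ P' j, f y ∈ P j)
      (hinj : ∀ j, ∀ y ∈ P' j, f y = 0 → y = 0)
      (hg : ∀ j, ∀ y ∈ P j, g y ∈ P'' j)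
      (hgf : ∀ j, ∀ y ∈ P' j, g (f y) = 0)
      (hex : ∀ j, ∀ y ∈ P j, g y = 0 → ∃ x ∈ P' j, f x = y)
      (hsurj : ∀ j, ∀ y ∈ P'' j, ∃ x ∈ P j, g x = y)
      (h' : Filtered 𝒰 P') (h'' : Filtered 𝒰 P'') : Filtered 𝒰 P

variable {S}

lemma Filtered.of_equiv {𝒰 : Set (ℕ → AddSubgroup A)} {E E' : Type} [AddCommGroup E]
    [Module A E] [AddCommGroup E'] [Module A E'] {P : ℕ → AddSubgroup E}
    {P' : ℕ → AddSubgroup E'} (h : S.Filtered 𝒰 P) (u : E ≃ₗ[A] E')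
    (hu : ∀ j y, y ∈ P j ↔ u y ∈ P' j)
    (hsmul : ∀ j, ∀ a ∈ S.piece j, ∀ y ∈ P' 0, a • y ∈ P' j) : S.Filtered 𝒰 P' := by
  refine .extension P P' (fun _ => (⊥ : AddSubgroup PUnit)) u.toLinearMap 0 hsmul
    (fun j y hy => (hu j y).1 hy) (fun j y _ hy => by simpa using hy)
    (fun j y _ => by simp) (fun j y _ => by simp)
    (fun j y hy _ => ⟨u.symm y, (hu j _).2 (by simpa using hy), by simp⟩)
    (fun j y _ => ⟨0, zero_mem _, Subsingleton.elim _ _⟩) h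
    (.zero _ fun j y _ => Subsingleton.elim _ _)

lemma IsMinimalGenerators.mem {E : Type} [AddCommGroup E] [Module A E] {P : ℕ → AddSubgroup E}
    {m : ℕ} {e : Fin m → E} (he : S.IsMinimalGenerators P e) (i : Fin m) : e i ∈ P 0 := by
  refine (he.2 0 _).2 ⟨Pi.single i 1, fun i' => ?_, by simp [Pi.single_apply]⟩
  by_cases h : i' = i
  · subst h
    simpa using S.one_mem
  · simp [h]

lemma append_mem {m n : ℕ} {p : Submodule k A} {a : Fin m → A} {b : Fin n → A}
    (ha : ∀ i, a i ∈ p) (hb : ∀ i, b i ∈ p) (i : Fin (m + n)) : Fin.append a b i ∈ p := by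
  refine Fin.addCases (fun i => ?_) (fun i => ?_) i
  · simpa using ha i
  · simpa using hb i

/-- Generators of an extension, obtained from generators of its two ends. -/
lemma IsMinimalGenerators.append {E' E E'' : Type} [AddCommGroup E'] [Module A E']
    [AddCommGroup E] [Module A E] [AddCommGroup E''] [Module A E'']
    {P' : ℕ → AddSubgroup E'} {P : ℕ → AddSubgroup E} {P'' : ℕ → AddSubgroup E''}
    {f : E' →ₗ[A] E} {g : E →ₗ[A] E''}
    (hsmul : ∀ j, ∀ a ∈ S.piece j, ∀ y ∈ P 0, a • y ∈ P j)
    (hf : ∀ j, ∀ y ∈ P' j, f y ∈ P j)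
    (hinj : ∀ j, ∀ y ∈ P' j, f y = 0 → y = 0)
    (hg : ∀ j, ∀ y ∈ P j, g y ∈ P'' j)
    (hex : ∀ j, ∀ y ∈ P j, g y = 0 → ∃ x ∈ P' j, f x = y)
    {m n : ℕ} {e' : Fin m → E'} {e'' : Fin n → E''} (he' : S.IsMinimalGenerators P' e')
    (he'' : S.IsMinimalGenerators P'' e'') {l : Fin n → E} (hl : ∀ i, l i ∈ P 0)
    (hgl : ∀ i, g (l i) = e'' i) (hgf : ∀ i, g (f (e' i)) = 0) :
    S.IsMinimalGenerators P (Fin.append (f ∘ e') l) := by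
  have hlP : ∀ j (a : Fin n → A), (∀ i, a i ∈ S.piece j) → ∑ i, a i • l i ∈ P j :=
    fun j a ha => sum_mem fun i _ => hsmul j _ (ha i) _ (hl i)
  refine ⟨fun a ha h => ?_, fun j y => ⟨fun hy => ?_, ?_⟩⟩
  · simp only [Fin.sum_univ_add, Fin.append_left, Fin.append_right, Function.comp_apply] at h
    have h2 : (fun i => a (Fin.natAdd m i)) = 0 := by
      refine he''.1 _ (fun i => ha _) ?_
      simpa [hgl, hgf] using congrArg g h
    have h2' : ∀ i, a (Fin.natAdd m i) = 0 := fun i => congrFun h2 i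
    have h1 : (fun i => a (Fin.castAdd n i)) = 0 := by
      refine he'.1 _ (fun i => ha _) ?_
      refine hinj 0 _ ((he'.2 0 _).2 ⟨_, fun i => ha _, rfl⟩) ?_
      simpa [h2'] using h
    funext i
    refine Fin.addCases (fun i => ?_) (fun i => ?_) i
    · exact congrFun h1 i
    · exact h2' i
  · obtain ⟨a'', ha'', h''⟩ := (he''.2 j _).1 (hg j y hy)
    obtain ⟨x, hx, hfx⟩ := hex j (y - ∑ i, a'' i • l i) (sub_mem hy (hlP j a'' ha''))
      (by simp [hgl, h''])
    obtain ⟨a', ha', h'⟩ := (he'.2 j x).1 hx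
    refine ⟨Fin.append a' a'', append_mem ha' ha'', ?_⟩
    have : f x = ∑ i, a' i • f (e' i) := by simp [← h']
    simp [Fin.sum_univ_add, ← this, hfx]
  · rintro ⟨a, ha, rfl⟩
    simp only [Fin.sum_univ_add, Fin.append_left, Fin.append_right, Function.comp_apply]
    refine add_mem ?_ (hlP j _ fun i => ha _)
    have := hf j _ ((he'.2 j _).2 ⟨fun i => a (Fin.castAdd n i), fun i => ha _, rfl⟩)
    simpa using this

/-- Extension of vectors by zero on the last coordinates. -/
def appendZero (A : Type) [CommRing A] (m n : ℕ) : (Fin m → A) →ₗ[A] (Fin (m + n) → A) where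
  toFun a := Fin.append a 0
  map_add' a b := by
    funext i
    refine Fin.addCases (fun i => ?_) (fun i => ?_) i <;> simp
  map_smul' c a := by
    funext i
    refine Fin.addCases (fun i => ?_) (fun i => ?_) i <;> simp

lemma Filtered.exists_generators {𝒰 : Set (ℕ → AddSubgroup A)}
    (h𝒰 : ∀ Q ∈ 𝒰, S.Filtered 𝒰 Q) {E : Type} [AddCommGroup E] [Module A E]
    {P : ℕ → AddSubgroup E} (h : S.Filtered 𝒰 P) :
    ∃ (m : ℕ) (e : Fin m → E), S.IsMinimalGenerators P e ∧ S.Filtered 𝒰 (S.syzygies e) := by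
  induction h with
  | zero P h =>
    refine ⟨0, Fin.elim0, ⟨fun a _ _ => Subsingleton.elim _ _, fun j y => ?_⟩,
      .zero _ fun j y _ => Subsingleton.elim _ _⟩
    constructor
    · intro hy
      exact ⟨Fin.elim0, fun i => i.elim0, by simp [h j y hy]⟩
    · rintro ⟨a, -, rfl⟩
      simp
  | cyclic P e he hP Q hQ hann =>
    refine ⟨1, fun _ => e, ⟨fun a ha h => ?_, fun j y => ?_⟩, ?_⟩
    · funext i
      rw [Subsingleton.elim i 0]
      exact he _ (ha 0) (by simpa using h)
    · rw [hP]
      constructor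
      · rintro ⟨a, ha, rfl⟩
        exact ⟨fun _ => a, fun _ => ha, by simp⟩
      · rintro ⟨a, ha, rfl⟩
        exact ⟨a 0, ha 0, by simp⟩
    · refine (h𝒰 Q hQ).of_equiv (LinearEquiv.funUnique (Fin 1) A A).symm (fun j y => ?_)
        (fun j a ha y hy => S.smul_mem_syzygies _ ha hy)
      rw [hann, mem_syzygies]
      simp
  | extension P' P P'' f g hsmul hf hinj hg hgf hex hsurj _ _ ih' ih'' =>
    obtain ⟨m, e', he', hs'⟩ := ih'
    obtain ⟨n, e'', he'', hs''⟩ := ih''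
    choose l hl hgl using fun i => hsurj 0 (e'' i) (he''.mem i)
    have hgf0 : ∀ i, g (f (e' i)) = 0 := fun i => hgf 0 _ (he'.mem i)
    have hgen := IsMinimalGenerators.append hsmul hf hinj hg hex he' he'' hl hgl hgf0
    refine ⟨m + n, Fin.append (f ∘ e') l, hgen, ?_⟩
    refine .extension _ _ _ (appendZero A m n) (LinearMap.funLeft A A (Fin.natAdd m))
      (fun j a ha y hy => S.smul_mem_syzygies _ ha hy) ?_ ?_ ?_ ?_ ?_ ?_ hs' hs''
    · rintro j a ⟨ha, ha'⟩
      refine ⟨append_mem ha fun _ => Submodule.zero_mem _, ?_⟩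
      have := congrArg f ha'
      simpa [appendZero, Fin.sum_univ_add] using this
    · intro j a _ h
      funext i
      simpa [appendZero] using congrFun h (Fin.castAdd n i)
    · rintro j a ⟨ha, ha'⟩
      refine ⟨fun i => ha _, ?_⟩
      have := congrArg g ha'
      simpa [Fin.sum_univ_add, hgf0, hgl, LinearMap.funLeft] using this
    · intro j a _
      funext i
      simp [appendZero, LinearMap.funLeft]
    · rintro j a ⟨ha, ha'⟩ h
      have h2 : ∀ i, a (Fin.natAdd m i) = 0 := fun i => congrFun h i
      refine ⟨fun i => a (Fin.castAdd n i), ⟨fun i => ha _, ?_⟩, ?_⟩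
      · refine hinj (j + 1) _ ((he'.2 _ _).2 ⟨_, fun i => ha _, rfl⟩) ?_
        simpa [Fin.sum_univ_add, h2] using ha'
      · funext i
        refine Fin.addCases (fun i => ?_) (fun i => ?_) i
        · simp [appendZero]
        · simp [appendZero, h2]
    · rintro j a ⟨ha, ha'⟩
      obtain ⟨x, hx, hfx⟩ := hex (j + 1) (∑ i, a i • l i)
        (sum_mem fun i _ => hsmul _ _ (ha i) _ (hl i)) (by simpa [hgl] using ha')
      obtain ⟨b, hb, rfl⟩ := (he'.2 _ _).1 hx
      refine ⟨Fin.append (-b) a, ⟨append_mem (fun i => Submodule.neg_mem _ (hb i)) ha, ?_⟩, ?_⟩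
      · simp only [map_sum, map_smul] at hfx
        simp [Fin.sum_univ_add, hfx]
      · funext i
        simp [LinearMap.funLeft]

/-- Coordinates of an element of `kᵐ ⊗ R_d` with respect to the standard basis of `kᵐ`. -/
def coords (S : GradedSystem k A) (m d : ℕ) :
    ((Fin m → k) ⊗[k] S.piece d) ≃ₗ[k] (Fin m → S.piece d) :=
  TensorProduct.comm k _ _ ≪≫ₗ TensorProduct.piScalarRight k k (S.piece d) (Fin m)

lemma coords_tmul (m d : ℕ) (v : Fin m → k) (a : S.piece d) (l : Fin m) :
    S.coords m d (v ⊗ₜ a) l = v l • a := by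
  simp [coords]

/-- The linear map `kᵐ → kⁿ ⊗ R₁` with prescribed coordinates of the images of the standard
basis vectors. -/
def ofLinearForms (S : GradedSystem k A) {m n : ℕ} (e : Fin m → Fin n → S.piece 1) :
    (Fin m → k) →ₗ[k] ((Fin n → k) ⊗[k] S.piece 1) :=
  Fintype.linearCombination k fun i => (S.coords n 1).symm (e i)

lemma coords_Dmap (n : ℕ → ℕ) (e : ∀ i, Fin (n (i + 1)) → Fin (n i) → S.piece 1) (i d : ℕ)
    (x : (Fin (n (i + 1)) → k) ⊗[k] S.piece d) :
    (fun l => (S.coords _ _ (S.Dmap n (fun i => S.ofLinearForms (e i)) i d x) l : A)) =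
      ∑ j, (S.coords _ _ x j : A) • fun l => (e i j l : A) := by
  have key : ∀ (w : (Fin (n i) → k) ⊗[k] S.piece 1) (a : S.piece d) (l : Fin (n i)),
      (S.coords _ _ ((LinearMap.lTensor (Fin (n i) → k)
        ((S.cast (add_comm 1 d)).toLinearMap ∘ₗ TensorProduct.lift (S.mulMap 1 d)))
        (TensorProduct.assoc k (Fin (n i) → k) (S.piece 1) (S.piece d) (w ⊗ₜ a))) l : A) =
      (S.coords _ _ w l : A) * a := by
    intro w a l
    induction w using TensorProduct.induction_on with
    | zero => simp
    | tmul v b => simp [coords_tmul, cast, mulMap]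
    | add x y hx hy => simp only [TensorProduct.add_tmul, map_add, Pi.add_apply,
        Submodule.coe_add, hx, hy, add_mul]
  induction x using TensorProduct.induction_on with
  | zero => simp; rfl
  | tmul v a =>
    funext l
    simp only [Dmap, LinearMap.comp_apply, LinearMap.rTensor_tmul, LinearEquiv.coe_coe]
    rw [key]
    simp [ofLinearForms, Fintype.linearCombination_apply, coords_tmul, Finset.mul_sum, mul_comm]
  | add x y hx hy =>
    simp only [map_add, Pi.add_apply, Submodule.coe_add, add_smul, Finset.sum_add_distrib, ← hx,
      ← hy]
    rfl

/-- If the irrelevant ideal admits a filtration with cyclic quotients whose annihilators are in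
`𝒰`, and so do the members of `𝒰`, then the algebra is Koszul. -/
theorem isKoszul_of_filtered (hone : S.ConnectedOne) {𝒰 : Set (ℕ → AddSubgroup A)}
    (h𝒰 : ∀ Q ∈ 𝒰, S.Filtered 𝒰 Q) (Q : ℕ → AddSubgroup A) (hQ𝒰 : Q ∈ 𝒰)
    (hQ : ∀ j a, a ∈ Q j ↔ a ∈ S.piece (j + 1)) : S.IsKoszul := by
  let Stage := {X : Σ m : ℕ, (ℕ → AddSubgroup (Fin m → A)) //
    S.Filtered 𝒰 X.2 ∧ ∀ y ∈ X.2 0, ∀ l, y l ∈ S.piece 1}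
  have hnext : ∀ X : Stage, ∃ (Y : Stage) (e : Fin Y.1.1 → Fin X.1.1 → S.piece 1),
      S.IsMinimalGenerators X.1.2 (fun i l => (e i l : A)) ∧
      ∀ j y, y ∈ Y.1.2 j ↔ y ∈ S.syzygies (fun i l => (e i l : A)) j := by
    rintro ⟨⟨m, P⟩, hP, hP1⟩
    obtain ⟨n, e, he, hs⟩ := hP.exists_generators h𝒰
    exact ⟨⟨⟨n, S.syzygies e⟩, hs, fun y hy l => hy.1 l⟩,
      fun i l => ⟨e i l, hP1 _ (he.mem i) l⟩, he, fun j y => Iff.rfl⟩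
  choose next e he hsyz using hnext
  have h1 : S.Filtered 𝒰 (fun j => (Q j).comap
      (LinearEquiv.funUnique (Fin 1) A A).toLinearMap.toAddMonoidHom) := by
    refine (h𝒰 Q hQ𝒰).of_equiv (LinearEquiv.funUnique (Fin 1) A A).symm (fun j y => ?_) ?_
    · simp
    · intro j a ha y hy
      simp only [AddSubgroup.mem_comap, hQ] at hy ⊢
      simpa using S.mul_mem ha hy
  let X0 : Stage := ⟨⟨1, _⟩, h1, fun y hy l => by
    rw [Subsingleton.elim l 0]
    simpa [hQ] using hy⟩
  let X : ℕ → Stage := fun i => Nat.rec X0 (fun _ Y => next Y) i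
  let n : ℕ → ℕ := fun i => (X i).1.1
  let E : ∀ i, Fin (n (i + 1)) → Fin (n i) → S.piece 1 := fun i => e (X i)
  have hgen : ∀ i, S.IsMinimalGenerators (X i).1.2 (fun j l => (E i j l : A)) :=
    fun i => he (X i)
  have hs : ∀ i j y, y ∈ (X (i + 1)).1.2 j ↔
      y ∈ S.syzygies (fun j l => (E i j l : A)) j := fun i => hsyz (X i)
  have hcoe : ∀ m d (x y : (Fin m → k) ⊗[k] S.piece d),
      (fun l => (S.coords _ _ x l : A)) = (fun l => (S.coords _ _ y l : A)) → x = y := by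
    intro m d x y h
    refine (S.coords m d).injective (funext fun l => Subtype.ext (congrFun h l))
  have hlift : ∀ i d (y : (Fin (n i) → k) ⊗[k] S.piece (d + 1)),
      (fun l => (S.coords _ _ y l : A)) ∈ (X i).1.2 d →
      ∃ x, S.Dmap n (fun i => S.ofLinearForms (E i)) i d x = y := by
    intro i d y hy
    obtain ⟨a, ha, hay⟩ := ((hgen i).2 d _).1 hy
    refine ⟨(S.coords _ _).symm fun j => ⟨a j, ha j⟩, hcoe _ _ _ _ ?_⟩
    rw [coords_Dmap, ← hay]
    simp
    rfl
  refine ⟨hone, n, fun i => S.ofLinearForms (E i), rfl, fun d y => hlift 0 d y ?_, fun i => ?_,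
    fun i d => ?_⟩
  · show _ ∈ (Q d).comap _
    simp [hQ]
  · rw [injective_iff_map_eq_zero]
    intro x hx
    have := coords_Dmap n E i 0 x
    rw [hx] at this
    have h0 := (hgen i).1 _ (fun j => (S.coords _ _ x j).2) (this.symm.trans (by simp; rfl))
    exact hcoe _ _ _ _ (h0.trans (by simp; rfl))
  · ext y
    have hker : y ∈ LinearMap.ker (S.Dmap n (fun i => S.ofLinearForms (E i)) i (d + 1)) ↔
        (fun l => (S.coords _ _ y l : A)) ∈ (X (i + 1)).1.2 d := by
      rw [hs, mem_syzygies, ← coords_Dmap n E i, LinearMap.mem_ker]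
      constructor
      · intro h
        refine ⟨fun j => (S.coords _ _ y j).2, ?_⟩
        rw [h]
        simp
        rfl
      · rintro ⟨-, h⟩
        exact hcoe _ _ _ _ (h.trans (by simp; rfl))
    rw [hker]
    constructor
    · rintro ⟨x, rfl⟩
      rw [coords_Dmap]
      exact ((hgen (i + 1)).2 d _).2 ⟨_, fun j => (S.coords _ _ x j).2, rfl⟩
    · exact hlift (i + 1) d y

end Linear

/-! ### Algebras of functions on a finite set of points -/

section Points

variable {k A ι : Type} [Field k] [CommRing A] [Algebra k A] (S : GradedSystem k A)

lemma pow_mem {a : A} (ha : a ∈ S.piece 1) (j : ℕ) : a ^ j ∈ S.piece j := by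
  induction j with
  | zero => simpa using S.one_mem
  | succ j ih => simpa [pow_succ] using S.mul_mem ih ha

/-- The homogeneous elements vanishing on `T`, with the grading shifted by one. -/
def vanishing (ev : A →ₐ[k] (ι → k)) (T : Finset ι) (j : ℕ) : AddSubgroup A where
  carrier := {a | a ∈ S.piece (j + 1) ∧ ∀ t ∈ T, ev a t = 0}
  zero_mem' := ⟨Submodule.zero_mem _, by simp⟩
  add_mem' := by
    rintro a b ⟨ha, ha'⟩ ⟨hb, hb'⟩
    exact ⟨Submodule.add_mem _ ha hb, fun t ht => by simp [ha' t ht, hb' t ht]⟩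
  neg_mem' := by
    rintro a ⟨ha, ha'⟩
    exact ⟨Submodule.neg_mem _ ha, fun t ht => by simp [ha' t ht]⟩

variable {S}

lemma mem_vanishing {ev : A →ₐ[k] (ι → k)} {T : Finset ι} {j : ℕ} {a : A} :
    a ∈ S.vanishing ev T j ↔ a ∈ S.piece (j + 1) ∧ ∀ t ∈ T, ev a t = 0 := Iff.rfl

lemma eq_zero_of_eval_mul_eq_zero (hone : S.ConnectedOne) (ev : A →ₐ[k] (ι → k)) {a w : A}
    (ha : a ∈ S.piece 0) {z : ι} (hw : ev w z ≠ 0) (h : ev (a * w) z = 0) : a = 0 := by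
  rw [hone, Submodule.mem_span_singleton] at ha
  obtain ⟨c, rfl⟩ := ha
  have : c = 0 := by simpa [hw] using h
  simp [this]

variable [Fintype ι] [DecidableEq ι]

lemma filtered_vanishing (hone : S.ConnectedOne) (ev : A →ₐ[k] (ι → k)) {r : ℕ} (hr : 1 ≤ r)
    (hcard : Fintype.card ι ≤ 2 * r)
    (hinj : ∀ n, ∀ a ∈ S.piece n, ev a = 0 → a = 0)
    (hsep : ∀ (T : Finset ι) (z : ι), z ∉ T → T.card ≤ r →
      ∃ w ∈ S.piece 1, (∀ t ∈ T, ev w t = 0) ∧ ev w z ≠ 0)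
    (hvan : ∀ T : Finset ι, T.card = r + 1 → ∀ a ∈ S.piece 1, (∀ t ∈ T, ev a t = 0) → a = 0)
    (T : Finset ι) (hT : T.card ≤ r) :
    S.Filtered {Q | ∃ T : Finset ι, T.card ≤ r ∧ Q = S.vanishing ev T} (S.vanishing ev T) := by
  induction hn : r - T.card generalizing T with
  | zero =>
    have hTr : T.card = r := by omega
    by_cases hTz : ∃ z, z ∉ T
    · obtain ⟨z₀, hz₀⟩ := hTz
      obtain ⟨l, hl, hlT, hlz₀⟩ := hsep T z₀ hz₀ hT
      have hlz : ∀ z, z ∉ T → ev l z ≠ 0 := by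
        intro z hz h
        refine hlz₀ ?_
        rw [hvan (insert z T) (by rw [Finset.card_insert_of_notMem hz, hTr]) l hl]
        · simp
        · simpa [h] using hlT
      refine .cyclic _ l
        (fun a ha h => eq_zero_of_eval_mul_eq_zero hone ev ha hlz₀
          (by simpa using congrFun (congrArg ev h) z₀)) ?_
        (S.vanishing ev Tᶜ) ⟨Tᶜ, by rw [Finset.card_compl]; omega, rfl⟩ ?_
      · intro j y
        constructor
        · rintro ⟨hy, hyT⟩
          rcases Nat.eq_zero_or_pos j with rfl | hj
          · refine ⟨(ev y z₀ / ev l z₀) • 1, Submodule.smul_mem _ _ S.one_mem, ?_⟩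
            rw [eq_comm, ← sub_eq_zero]
            refine hvan (insert z₀ T) (by rw [Finset.card_insert_of_notMem hz₀, hTr]) _
              (Submodule.sub_mem _ hy (by simpa using Submodule.smul_mem _ _ hl)) ?_
            simp +contextual [hlT, hyT, hlz₀]
          · have hb : ∀ z, ∃ b ∈ S.piece 1, (∀ t ∈ Tᶜ.erase z, ev b t = 0) ∧ ev b z ≠ 0 :=
              fun z => hsep _ z (by simp) (by
                have := Finset.card_erase_le (s := Tᶜ) (a := z)
                rw [Finset.card_compl] at this
                omega)
            choose b hb hb0 hb1 using hb
            have hmem : ∑ z ∈ Tᶜ, (ev y z / (ev l z * ev (b z) z ^ j)) • b z ^ j ∈ S.piece j :=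
              Submodule.sum_mem _ fun z _ => Submodule.smul_mem _ _ (S.pow_mem (hb z) j)
            refine ⟨_, hmem, ?_⟩
            rw [← sub_eq_zero]
            refine hinj (j + 1) _ (Submodule.sub_mem _ (S.mul_mem hmem hl) hy) ?_
            funext t
            by_cases ht : t ∈ T
            · simp [hlT t ht, hyT t ht]
            · have : ∀ z ∈ Tᶜ, z ≠ t → (ev y z / (ev l z * ev (b z) z ^ j)) * ev (b z) t ^ j = 0 := by
                intro z _ hzt
                rw [hb0 z t (by simp [ht, hzt.symm])]
                simp [hj.ne']
              have hs := Finset.sum_eq_single_of_mem t (by simpa using ht) this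
              simp only [smul_eq_mul, map_sub, map_mul, map_sum, map_smul, map_pow, Pi.sub_apply,
                Pi.mul_apply, Finset.sum_apply, Pi.smul_apply, Pi.pow_apply, hs, Pi.zero_apply]
              have := hlz t ht
              have := hb1 t
              field_simp
              ring
        · rintro ⟨a, ha, rfl⟩
          exact ⟨S.mul_mem ha hl, fun t ht => by simp [hlT t ht]⟩
      · intro j a
        rw [mem_vanishing]
        refine and_congr_right fun ha => ⟨fun h => hinj (j + 1 + 1) _ (S.mul_mem ha hl) ?_,
          fun h t ht => ?_⟩
        · funext t
          by_cases ht : t ∈ T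
          · simp [hlT t ht]
          · simp [h t (by simpa using ht)]
        · have := congrFun (congrArg ev h) t
          simpa [hlz t (by simpa using ht)] using this
    · push Not at hTz
      exact .zero _ fun j y hy => hinj _ y hy.1 (funext fun t => hy.2 t (hTz t))
  | succ m ih =>
    by_cases hTz : ∃ z, z ∉ T
    · obtain ⟨z, hz⟩ := hTz
      have hins := Finset.card_insert_of_notMem hz
      obtain ⟨w, hw, hwT, hwz⟩ := hsep T z hz hT
      let evz : A →+* k := (Pi.evalRingHom (fun _ => k) z).comp ev.toRingHom
      have hker : ∀ a, (RingHom.ker evz).mkQ a = 0 ↔ ev a z = 0 := fun a => by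
        rw [Submodule.mkQ_apply, Submodule.Quotient.mk_eq_zero, RingHom.mem_ker]
        rfl
      let P'' : ℕ → AddSubgroup (A ⧸ RingHom.ker evz) := fun j =>
        (S.vanishing ev T j).map (RingHom.ker evz).mkQ.toAddMonoidHom
      refine .extension (S.vanishing ev (insert z T)) _ P'' LinearMap.id (RingHom.ker evz).mkQ
        ?_ ?_ ?_ ?_ ?_ ?_ ?_ (ih _ (by omega) (by omega)) ?_
      · rintro j a ha y ⟨hy, hyT⟩
        exact ⟨S.mul_mem ha hy, fun t ht => by simp [hyT t ht]⟩
      · rintro j y ⟨hy, hyT⟩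
        exact ⟨hy, fun t ht => hyT t (by simp [ht])⟩
      · simp
      · exact fun j y hy => ⟨y, hy, rfl⟩
      · rintro j y ⟨_, hyT⟩
        exact (hker _).2 (hyT z (by simp))
      · rintro j y ⟨hy, hyT⟩ h
        exact ⟨y, ⟨hy, by simpa [(hker _).1 h] using hyT⟩, rfl⟩
      · exact fun j y hy => hy
      · refine .cyclic _ ((RingHom.ker evz).mkQ w) (fun a ha h => ?_) (fun j y => ?_)
          (S.vanishing ev {z}) ⟨{z}, by simpa using hr, rfl⟩ (fun j a => ?_)
        · rw [← map_smul, hker] at h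
          exact eq_zero_of_eval_mul_eq_zero hone ev ha hwz h
        · constructor
          · rintro ⟨y, ⟨hy, hyT⟩, rfl⟩
            refine ⟨(ev y z / ev w z ^ (j + 1)) • w ^ j,
              Submodule.smul_mem _ _ (S.pow_mem hw j), ?_⟩
            rw [← map_smul, ← sub_eq_zero]
            refine (map_sub _ _ _).symm.trans ((hker _).2 ?_)
            simp only [smul_eq_mul, map_sub, map_mul, map_smul, map_pow, Pi.sub_apply,
              Pi.mul_apply, Pi.smul_apply, Pi.pow_apply]
            field_simp
            ring
          · rintro ⟨a, ha, rfl⟩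
            exact ⟨a * w, ⟨S.mul_mem ha hw, fun t ht => by simp [hwT t ht]⟩, rfl⟩
        · rw [mem_vanishing, ← map_smul, hker]
          simp [hwz]
    · push Not at hTz
      exact .zero _ fun j y hy => hinj _ y hy.1 (funext fun t => hy.2 t (hTz t))

end Points

end GradedSystem

/-! ### Points in general linear position -/

section GeneralPosition

variable {k : Type} [Field k] {N d : ℕ}

lemma eval_eq_zero_of_mem_pointsIdeal (x : Fin d → (Fin N → k)) {q : MvPolynomial (Fin N) k}
    (hq : q ∈ pointsIdeal k x) (j : Fin d) : MvPolynomial.eval (x j) q = 0 := by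
  have : pointsIdeal k x ≤ RingHom.ker (MvPolynomial.eval (x j)) :=
    Ideal.span_le.2 fun q hq => hq.2 j
  exact this hq

/-- Evaluation of elements of the homogeneous coordinate algebra at the points. -/
def pointsEval (x : Fin d → (Fin N → k)) :
    (MvPolynomial (Fin N) k ⧸ pointsIdeal k x) →ₐ[k] (Fin d → k) :=
  Ideal.Quotient.liftₐ _ (AlgHom.pi fun j => MvPolynomial.aeval (x j)) fun q hq => by
    funext j
    simpa [MvPolynomial.aeval_eq_eval] using eval_eq_zero_of_mem_pointsIdeal x hq j

lemma pointsEval_mk (x : Fin d → (Fin N → k)) (q : MvPolynomial (Fin N) k) (j : Fin d) :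
    pointsEval x (Ideal.Quotient.mk _ q) j = MvPolynomial.eval (x j) q := by
  change MvPolynomial.aeval (x j) q = _
  rw [MvPolynomial.aeval_eq_eval]

lemma mem_pointsSystem_piece (x : Fin d → (Fin N → k)) {n : ℕ}
    {a : MvPolynomial (Fin N) k ⧸ pointsIdeal k x} :
    a ∈ (pointsSystem k x).piece n ↔
      ∃ q : MvPolynomial (Fin N) k, q.IsHomogeneous n ∧ Ideal.Quotient.mk _ q = a :=
  Iff.rfl

lemma connectedOne_pointsSystem (x : Fin d → (Fin N → k)) :
    (pointsSystem k x).ConnectedOne := by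
  refine le_antisymm ?_ ?_
  · intro a ha
    obtain ⟨q, hq, rfl⟩ := (mem_pointsSystem_piece x).1 ha
    rw [← MvPolynomial.totalDegree_zero_iff_isHomogeneous,
      MvPolynomial.totalDegree_eq_zero_iff_eq_C] at hq
    rw [Submodule.mem_span_singleton, hq]
    exact ⟨_, (Algebra.algebraMap_eq_smul_one _).symm⟩
  · rw [Submodule.span_singleton_le_iff_mem]
    exact (pointsSystem k x).one_mem

lemma eq_zero_of_pointsEval_eq_zero (x : Fin d → (Fin N → k)) {n : ℕ}
    {a : MvPolynomial (Fin N) k ⧸ pointsIdeal k x} (ha : a ∈ (pointsSystem k x).piece n)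
    (h : pointsEval x a = 0) : a = 0 := by
  obtain ⟨q, hq, rfl⟩ := (mem_pointsSystem_piece x).1 ha
  refine Ideal.Quotient.eq_zero_iff_mem.2 (Ideal.subset_span ⟨⟨n, hq⟩, fun j => ?_⟩)
  rw [← pointsEval_mk, h, Pi.zero_apply]

/-- Every functional comes from a linear form. -/
lemma exists_mem_piece_one (x : Fin d → (Fin N → k)) (f : (Fin N → k) →ₗ[k] k) :
    ∃ w ∈ (pointsSystem k x).piece 1, ∀ j, pointsEval x w j = f (x j) := by
  refine ⟨_, (mem_pointsSystem_piece x).2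
    ⟨∑ i, MvPolynomial.C (f (Pi.single i 1)) * MvPolynomial.X i, ?_, rfl⟩, fun j => ?_⟩
  · refine MvPolynomial.IsHomogeneous.sum _ _ _ fun i _ => ?_
    simpa using (MvPolynomial.isHomogeneous_C _ _).mul (MvPolynomial.isHomogeneous_X k i)
  · rw [pointsEval_mk]
    conv_rhs => rw [← Finset.univ_sum_single (x j), map_sum]
    refine (map_sum _ _ _).trans (Finset.sum_congr rfl fun i _ => ?_)
    have : Pi.single i (x j i) = x j i • (Pi.single i 1 : Fin N → k) := by
      rw [← Pi.single_smul, smul_eq_mul, mul_one]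
    simp [this, mul_comm]

/-- Every linear form comes from a functional. -/
lemma exists_functional (x : Fin d → (Fin N → k))
    {a : MvPolynomial (Fin N) k ⧸ pointsIdeal k x} (ha : a ∈ (pointsSystem k x).piece 1) :
    ∃ f : (Fin N → k) →ₗ[k] k, ∀ j, pointsEval x a j = f (x j) := by
  obtain ⟨q, hq, rfl⟩ := (mem_pointsSystem_piece x).1 ha
  rw [← MvPolynomial.mem_homogeneousSubmodule, MvPolynomial.homogeneousSubmodule_one_eq_span_X,
    Submodule.mem_span_range_iff_exists_fun] at hq
  obtain ⟨c, rfl⟩ := hq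
  refine ⟨∑ i, c i • LinearMap.proj i, fun j => ?_⟩
  rw [pointsEval_mk]
  simp [MvPolynomial.smul_eval]

end GeneralPosition

theorem kempf_points_koszul (k : Type) [Field k] (d p : ℕ)
    (hd : 0 < d) (hp : 2 * p ≤ d)
    (x : Fin d → (Fin (d - p + 1) → k))
    (hx0 : ∀ j, x j ≠ 0)
    (hdist : ∀ i j : Fin d, i ≠ j → ∀ c : k, x i ≠ c • x j)
    (hgen : ∀ s : Finset (Fin d), s.card ≤ d - p + 1 →
      LinearIndependent k (fun j : s => x (j : Fin d))) :
    (pointsSystem k x).IsKoszul := by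
  have hsep : ∀ (T : Finset (Fin d)) (z : Fin d), z ∉ T → T.card ≤ d - p →
      ∃ w ∈ (pointsSystem k x).piece 1, (∀ t ∈ T, pointsEval x w t = 0) ∧
        pointsEval x w z ≠ 0 := by
    intro T z hz hT
    have hli := hgen (insert z T) (by rw [Finset.card_insert_of_notMem hz]; omega)
    let v : (insert z T : Finset (Fin d)) := ⟨z, by simp⟩
    obtain ⟨f, hf⟩ := LinearMap.exists_extend hli.repr
    obtain ⟨w, hw, hwf⟩ := exists_mem_piece_one x (Finsupp.lapply v ∘ₗ f)
    have key : ∀ t : (insert z T : Finset (Fin d)), f (x t) = Finsupp.single t 1 := by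
      intro t
      rw [← hli.repr_eq_single t ⟨x (t : Fin d), Submodule.subset_span ⟨t, rfl⟩⟩ rfl]
      exact LinearMap.congr_fun hf ⟨x t, Submodule.subset_span ⟨t, rfl⟩⟩
    refine ⟨w, hw, fun t ht => ?_, ?_⟩
    · rw [hwf]
      have hne : (⟨t, by simp [ht]⟩ : (insert z T : Finset (Fin d))) ≠ v := by
        intro h
        obtain rfl : t = z := congrArg Subtype.val h
        exact hz ht
      have := key ⟨t, by simp [ht]⟩
      simp only at this
      simp [this, hne]
    · rw [hwf]
      have : f (x z) = _ := key v
      simp [this]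
  have hvan : ∀ T : Finset (Fin d), T.card = d - p + 1 → ∀ a ∈ (pointsSystem k x).piece 1,
      (∀ t ∈ T, pointsEval x a t = 0) → a = 0 := by
    intro T hT a ha h
    obtain ⟨f, hf⟩ := exists_functional x ha
    have hspan := (hgen T hT.le).span_eq_top_of_card_eq_finrank' (by simp [hT])
    have hf0 : f = 0 := by
      refine LinearMap.ext_on_range hspan fun t => ?_
      simpa [← hf] using h t t.2
    refine eq_zero_of_pointsEval_eq_zero x ha (funext fun j => ?_)
    simp [hf, hf0]
  have hfil := GradedSystem.filtered_vanishing (connectedOne_pointsSystem x) (pointsEval x)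
    (r := d - p) (by omega) (by simp; omega)
    (fun n a ha => eq_zero_of_pointsEval_eq_zero x ha) hsep hvan
  refine GradedSystem.isKoszul_of_filtered (connectedOne_pointsSystem x)
    (𝒰 := {Q | ∃ T : Finset (Fin d), T.card ≤ d - p ∧
      Q = (pointsSystem k x).vanishing (pointsEval x) T}) ?_
    ((pointsSystem k x).vanishing (pointsEval x) ∅) ⟨∅, by simp, rfl⟩
    fun j a => by simp [GradedSystem.mem_vanishing]
  rintro _ ⟨T, hT, rfl⟩
  exact hfil T hT

end
end
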